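/- Let k be a field and let t ≤ p be positive integers. Let R = k[y_{ij} : 1 ≤ i ≤ j ≤ p] be the polynomial ring with maximal homogeneous ideal 𝔪, let Y be the symmetric p×p matrix whose (i,j)-entry is y_{min(i,j),max(i,j)}, and let I = I_t(Y) be the ideal generated by the determinants of all t×t submatrices of Y. Set h = (p−t+1)(p−t+2)/2. Then for all integers m, r ≥ 1 one has the containment I^{(r(h+m−1))} ⊆ 𝔪^{r(h−1)} · (I^{(m)})^r. -/

import Mathlib

/-- The `n`-th symbolic power of an ideal `I`:
`f ∈ I^{(n)}` iff for every associated prime `P` of `R/I` there is `s ∉ P` with `s*f ∈ I^n`.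
(For a prime ideal `I` this is exactly `{f | ∃ s ∉ I, s*f ∈ I^n} = Iⁿ R_I ∩ R`.) -/
def symbolicPower {R : Type*} [CommRing R] (I : Ideal R) (n : ℕ) : Ideal R where
  carrier := {f | ∀ P ∈ associatedPrimes R (R ⧸ I), ∃ s, s ∉ P ∧ s * f ∈ I ^ n}
  zero_mem' := by
    intro P hP
    exact ⟨1, fun h => hP.1.ne_top ((Ideal.eq_top_iff_one P).mpr h), by simp⟩
  add_mem' := by
    intro a b ha hb P hP
    obtain ⟨s, hs, hsa⟩ := ha P hP
    obtain ⟨t, ht, htb⟩ := hb P hP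
    refine ⟨s * t, fun h => ((hP.1.mem_or_mem h).elim hs ht), ?_⟩
    have heq : s * t * (a + b) = t * (s * a) + s * (t * b) := by ring
    rw [heq]
    exact Ideal.add_mem _ (Ideal.mul_mem_left _ _ hsa) (Ideal.mul_mem_left _ _ htb)
  smul_mem' := by
    intro r a ha P hP
    obtain ⟨s, hs, hsa⟩ := ha P hP
    refine ⟨s, hs, ?_⟩
    have heq : s * (r • a) = r * (s * a) := by rw [smul_eq_mul]; ring
    rw [heq]
    exact Ideal.mul_mem_left _ _ hsa

/-- The set of `t×t` minors of the generic symmetric `p×p` matrix `Y`, whose `(i,j)`-entry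
is the indeterminate `y_{min(i,j), max(i,j)}` indexed by pairs `i ≤ j`. -/
def genericSymMinors (k : Type*) [Field k] (p t : ℕ) :
    Set (MvPolynomial {ij : Fin p × Fin p // ij.1 ≤ ij.2} k) :=
  {f | ∃ ri ci : Fin t → Fin p,
    Function.Injective ri ∧ Function.Injective ci ∧
      f = Matrix.det (Matrix.of fun a b : Fin t =>
        MvPolynomial.X (⟨(min (ri a) (ci b), max (ri a) (ci b)), min_le_max⟩ :
          {ij : Fin p × Fin p // ij.1 ≤ ij.2}))}

namespace GenSym

open Finset MvPolynomial
open scoped MonomialOrder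

lemma prod_mem_pow_card {S ι : Type*} [CommRing S] (I : Ideal S) (s A : Finset ι)
    (hA : A ⊆ s) (x : ι → S) (hx : ∀ i ∈ A, x i ∈ I) : ∏ i ∈ s, x i ∈ I ^ #A := by
  classical
  rw [← Finset.prod_sdiff hA]
  refine Ideal.mul_mem_left _ _ ?_
  rw [← Finset.prod_const]
  exact Ideal.prod_mem_prod hx

/-- If every row of a square matrix is, modulo an ideal `I`, a combination of `card κ` fixed rows,
then the determinant lies in `I ^ (size - card κ)`. -/
lemma det_mem_pow {S κ : Type*} [CommRing S] [Fintype κ] {s : ℕ}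
    (c : Fin s → κ → S) (u : κ → Fin s → S) (w : Fin s → Fin s → S) (I : Ideal S)
    (hw : ∀ q l, w q l ∈ I) :
    Matrix.det (Matrix.of fun q l => ∑ j, c q j * u j l + w q l) ∈ I ^ (s - Fintype.card κ) := by
  classical
  let v : Fin s → Option κ → Fin s → S := fun q o => o.elim (w q) (fun j => c q j • u j)
  have hrow : (Matrix.of fun q l => ∑ j, c q j * u j l + w q l : Matrix (Fin s) (Fin s) S)
      = Matrix.of fun q => ∑ o, v q o := by
    ext q l
    simp [v, Fintype.sum_option, Finset.sum_apply, add_comm]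
  rw [hrow]
  have := (Matrix.detRowAlternating (n := Fin s) (R := S)).toMultilinearMap.map_sum v
  change Matrix.det (Matrix.of fun q => ∑ o, v q o) =
    ∑ r : Fin s → Option κ, Matrix.det (Matrix.of fun q => v q (r q)) at this
  rw [this]
  refine Ideal.sum_mem _ fun r _ => ?_
  by_cases hr : ∃ q q' : Fin s, q ≠ q' ∧ ∃ j, r q = some j ∧ r q' = some j
  · obtain ⟨q, q', hne, j, h1, h2⟩ := hr
    let d : Fin s → S := fun a => (r a).elim 1 (c a)
    let M : Matrix (Fin s) (Fin s) S := fun a => (r a).elim (w a) u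
    have hM : (Matrix.of fun a => v a (r a)) = Matrix.of fun a l => d a * M a l := by
      ext a l
      simp only [v, d, M, Matrix.of_apply]
      cases r a <;> simp
    rw [hM, Matrix.det_mul_column, Matrix.det_zero_of_row_eq hne (by simp [M, h1, h2]), mul_zero]
    exact Ideal.zero_mem _
  · push Not at hr
    set A : Finset (Fin s) := univ.filter fun q => r q = none with hA
    have hcard : s - Fintype.card κ ≤ #A := by
      have h1 : #(univ.filter fun q => ¬ r q = none) ≤ Fintype.card κ := by
        have : ∀ q, ¬ r q = none → ∃ j, r q = some j := fun q => Option.ne_none_iff_exists'.1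
        rw [← Fintype.card_subtype]
        refine Fintype.card_le_of_injective
          (fun q : {q // ¬ r q = none} => (this q.1 q.2).choose) fun q q' hq => ?_
        by_contra hne
        have e1 := (this q.1 q.2).choose_spec
        have e2 := (this q'.1 q'.2).choose_spec
        exact hr q.1 q'.1 (fun h => hne (Subtype.ext h)) _ e1 (by rw [e2]; exact congrArg _ hq.symm)
      have h2 := Finset.card_filter_add_card_filter_not (s := (univ : Finset (Fin s)))
        (fun q => r q = none)
      simp only [Finset.card_univ, Fintype.card_fin] at h2
      rw [hA]
      omega
    refine Ideal.pow_le_pow_right hcard ?_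
    rw [← Matrix.det_transpose, Matrix.det_apply]
    refine Ideal.sum_mem _ fun σ _ => Submodule.smul_of_tower_mem _ _ ?_
    refine prod_mem_pow_card I univ A (subset_univ _) _ fun i hi => ?_
    have hi : r i = none := by simpa [hA] using hi
    simp [v, hi, hw]

/-- The index type of the variables of a generic symmetric `p × p` matrix. -/
abbrev Idx (p : ℕ) : Type := {ij : Fin p × Fin p // ij.1 ≤ ij.2}

/-- The generic symmetric matrix. -/
noncomputable def symMat (k : Type*) [Field k] (p : ℕ) :
    Matrix (Fin p) (Fin p) (MvPolynomial (Idx p) k) :=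
  Matrix.of fun i j => X ⟨(min i j, max i j), min_le_max⟩

/-- The minor of the generic symmetric matrix with rows `a` and columns `b`. -/
noncomputable def minor (k : Type*) [Field k] {p s : ℕ} (a b : Fin s → Fin p) :
    MvPolynomial (Idx p) k :=
  ((symMat k p).submatrix a b).det

/-- The ideal generated by the variables. -/
noncomputable def varIdeal (k : Type*) [Field k] (p : ℕ) : Ideal (MvPolynomial (Idx p) k) :=
  Ideal.span (Set.range X)

/-- The ideal of minors of size `s`. -/
noncomputable def detIdeal (k : Type*) [Field k] (p s : ℕ) : Ideal (MvPolynomial (Idx p) k) :=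
  Ideal.span (genericSymMinors k p s)

section

variable {k : Type*} [Field k] {p : ℕ}

lemma minor_mem_detIdeal {s : ℕ} {a b : Fin s → Fin p} (ha : a.Injective) (hb : b.Injective) :
    minor k a b ∈ detIdeal k p s :=
  Ideal.subset_span ⟨a, b, ha, hb, rfl⟩

lemma detIdeal_le {s : ℕ} {I : Ideal (MvPolynomial (Idx p) k)}
    (h : ∀ a b : Fin s → Fin p, a.Injective → b.Injective → minor k a b ∈ I) :
    detIdeal k p s ≤ I := by
  rw [detIdeal, Ideal.span_le]
  rintro _ ⟨a, b, ha, hb, rfl⟩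
  exact h a b ha hb

lemma symMat_mem_varIdeal (i j : Fin p) : symMat k p i j ∈ varIdeal k p :=
  Ideal.subset_span ⟨_, rfl⟩

lemma detIdeal_succ_le (s : ℕ) : detIdeal k p (s + 1) ≤ varIdeal k p * detIdeal k p s := by
  refine detIdeal_le fun a b ha hb => ?_
  rw [minor, Matrix.det_succ_row_zero]
  refine Ideal.sum_mem _ fun j _ => ?_
  rw [mul_assoc]
  refine Ideal.mul_mem_left _ _ (Ideal.mul_mem_mul (symMat_mem_varIdeal _ _) ?_)
  exact minor_mem_detIdeal (ha.comp (Fin.succ_injective s)) (hb.comp Fin.succAbove_right_injective)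

lemma detIdeal_add_le (s w : ℕ) :
    detIdeal k p (s + w) ≤ varIdeal k p ^ w * detIdeal k p s := by
  induction w with
  | zero => simp
  | succ w ih =>
    rw [pow_succ', mul_assoc]
    exact (detIdeal_succ_le _).trans (Ideal.mul_mono_right ih)

/-- Products of minors, where a minor of size `s` has weight `s - τ`. -/
inductive MinorProd (k : Type*) [Field k] (p τ : ℕ) : ℕ → MvPolynomial (Idx p) k → Prop
  | one : MinorProd k p τ 0 1
  | mul {s n : ℕ} {f : MvPolynomial (Idx p) k} (a b : Fin s → Fin p) (ha : a.Injective)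
      (hb : b.Injective) (hf : MinorProd k p τ n f) :
      MinorProd k p τ (n + (s - τ)) (minor k a b * f)

/-- The ideal generated by the products of minors of weight at least `N`. -/
noncomputable def weightIdeal (k : Type*) [Field k] (p τ N : ℕ) :
    Ideal (MvPolynomial (Idx p) k) :=
  Ideal.span {f | ∃ n, N ≤ n ∧ MinorProd k p τ n f}

variable {τ : ℕ}

lemma MinorProd.mul_prod {n n' : ℕ} {f g : MvPolynomial (Idx p) k}
    (hf : MinorProd k p τ n f) (hg : MinorProd k p τ n' g) :
    MinorProd k p τ (n + n') (f * g) := by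
  induction hf with
  | one => simpa using hg
  | mul a b ha hb _ ih =>
    rw [mul_assoc, add_right_comm]
    exact .mul a b ha hb ih

lemma minorProd_minor {s : ℕ} {a b : Fin s → Fin p} (ha : a.Injective) (hb : b.Injective) :
    MinorProd k p τ (s - τ) (minor k a b) := by
  simpa using MinorProd.mul a b ha hb MinorProd.one

lemma MinorProd.mem_weightIdeal {n N : ℕ} {f : MvPolynomial (Idx p) k}
    (hf : MinorProd k p τ n f) (h : N ≤ n) : f ∈ weightIdeal k p τ N :=
  Ideal.subset_span ⟨n, h, hf⟩

lemma weightIdeal_antitone {N N' : ℕ} (h : N ≤ N') :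
    weightIdeal k p τ N' ≤ weightIdeal k p τ N :=
  Ideal.span_mono fun _ ⟨n, hn, hf⟩ => ⟨n, h.trans hn, hf⟩

lemma weightIdeal_mul_le (N N' : ℕ) :
    weightIdeal k p τ N * weightIdeal k p τ N' ≤ weightIdeal k p τ (N + N') := by
  rw [weightIdeal, weightIdeal, Ideal.span_mul_span', Ideal.span_le]
  rintro _ ⟨f, ⟨n, hn, hf⟩, g, ⟨n', hn', hg⟩, rfl⟩
  exact (hf.mul_prod hg).mem_weightIdeal (by omega)

lemma weightIdeal_zero : weightIdeal k p τ 0 = ⊤ :=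
  (Ideal.eq_top_iff_one _).2 (MinorProd.one.mem_weightIdeal le_rfl)

lemma detIdeal_le_weightIdeal (s : ℕ) : detIdeal k p s ≤ weightIdeal k p τ (s - τ) :=
  detIdeal_le fun _ _ ha hb => (minorProd_minor ha hb).mem_weightIdeal le_rfl

lemma detIdeal_le_varIdeal_pow (s : ℕ) : detIdeal k p s ≤ varIdeal k p ^ s := by
  simpa using (detIdeal_add_le (k := k) (p := p) 0 s).trans Ideal.mul_le_left

lemma MinorProd.mem_varIdeal_pow {n : ℕ} {f : MvPolynomial (Idx p) k}
    (hf : MinorProd k p τ n f) : f ∈ varIdeal k p ^ n := by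
  induction hf with
  | one => simp
  | mul a b ha hb _ ih =>
    rw [add_comm, pow_add]
    exact Ideal.mul_mem_mul (Ideal.pow_le_pow_right (Nat.sub_le _ _)
      (detIdeal_le_varIdeal_pow _ (minor_mem_detIdeal ha hb))) ih

lemma weightIdeal_le_varIdeal_pow (N : ℕ) : weightIdeal k p τ N ≤ varIdeal k p ^ N := by
  rw [weightIdeal, Ideal.span_le]
  rintro f ⟨n, hn, hf⟩
  exact Ideal.pow_le_pow_right hn hf.mem_varIdeal_pow

lemma weightIdeal_one_le : weightIdeal k p τ 1 ≤ detIdeal k p (τ + 1) := by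
  rw [weightIdeal, Ideal.span_le]
  rintro f ⟨n, hn, hf⟩
  induction hf with
  | one => omega
  | @mul s n f a b ha hb hf ih =>
    rcases Nat.eq_zero_or_pos (s - τ) with h | h
    · exact Ideal.mul_mem_left _ _ (ih (by omega))
    · refine Ideal.mul_mem_right _ _ ?_
      obtain ⟨w, rfl⟩ : ∃ w, s = τ + 1 + w := ⟨s - (τ + 1), by omega⟩
      exact ((detIdeal_add_le _ _).trans Ideal.mul_le_right) (minor_mem_detIdeal (k := k) ha hb)

/-- Splitting a product of minors greedily into groups of weight `m`. -/
lemma MinorProd.group {m n : ℕ} (hm : 1 ≤ m) {f : MvPolynomial (Idx p) k}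
    (hf : MinorProd k p τ n f) (r E x : ℕ) (hx : x < m) (hE : r * (p - τ - 1) ≤ E)
    (h : r * m + E ≤ x + n) {g : MvPolynomial (Idx p) k} (hg : g ∈ weightIdeal k p τ x) :
    g * f ∈ varIdeal k p ^ E * weightIdeal k p τ m ^ r := by
  induction hf generalizing r E x g with
  | one =>
    obtain rfl : r = 0 := by
      by_contra hr
      nlinarith [Nat.pos_of_ne_zero hr]
    simpa using Ideal.pow_le_pow_right (by omega : E ≤ x) (weightIdeal_le_varIdeal_pow _ hg)
  | @mul s n f a b ha hb hf ih =>
    have hs : s ≤ p := by simpa using Fintype.card_le_of_injective a ha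
    rcases Nat.eq_zero_or_pos r with rfl | hr
    · have := Ideal.mul_mem_mul (weightIdeal_le_varIdeal_pow _ hg)
        (MinorProd.mul (τ := τ) a b ha hb hf).mem_varIdeal_pow
      rw [← pow_add] at this
      simpa using Ideal.pow_le_pow_right (by omega) this
    obtain ⟨r, rfl⟩ : ∃ r', r = r' + 1 := ⟨r - 1, by omega⟩
    rw [add_mul, one_mul] at h hE
    rw [← mul_assoc]
    rcases lt_or_ge (x + (s - τ)) m with hlt | hge
    · refine ih (r + 1) E (x + (s - τ)) hlt (by linarith) (by linarith) ?_
      exact weightIdeal_mul_le _ _ (Ideal.mul_mem_mul hg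
        ((minorProd_minor ha hb).mem_weightIdeal le_rfl))
    · obtain ⟨w, hw⟩ := Nat.exists_eq_add_of_le hge
      have hwE : w ≤ p - τ - 1 := by omega
      have h1 : g * minor k a b ∈ varIdeal k p ^ w * weightIdeal k p τ m := by
        have h2 : minor k a b ∈ varIdeal k p ^ w * detIdeal k p (m - x + τ) := by
          apply detIdeal_add_le
          obtain rfl : s = m - x + τ + w := by omega
          exact minor_mem_detIdeal ha hb
        have h3 := Ideal.mul_mem_mul hg
          (Ideal.mul_mono_right (detIdeal_le_weightIdeal (τ := τ) _) h2)
        rw [mul_left_comm] at h3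
        refine Ideal.mul_mono_right ?_ h3
        refine (weightIdeal_mul_le _ _).trans (weightIdeal_antitone ?_)
        omega
      have h2 := ih r (E - w) 0 (by omega) (by omega) (by omega)
        (g := 1) (by simp [weightIdeal_zero])
      have h3 := Ideal.mul_mem_mul h1 h2
      rw [one_mul] at h3
      have h4 : varIdeal k p ^ w * weightIdeal k p τ m *
          (varIdeal k p ^ (E - w) * weightIdeal k p τ m ^ r) =
          varIdeal k p ^ (w + (E - w)) * weightIdeal k p τ m ^ (r + 1) := by
        rw [pow_add, pow_succ]; ring
      rwa [h4, Nat.add_sub_cancel' (by omega)] at h3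

lemma weightIdeal_le_mul_pow {h m r : ℕ} (hm : 1 ≤ m) (hh : p - τ ≤ h) (h1 : 1 ≤ h) :
    weightIdeal k p τ (r * (h + m - 1)) ≤
      varIdeal k p ^ (r * (h - 1)) * weightIdeal k p τ m ^ r := by
  rw [weightIdeal, Ideal.span_le]
  rintro f ⟨n, hn, hf⟩
  have e : r * (h + m - 1) = r * m + r * (h - 1) := by
    rw [← mul_add]; congr 1; omega
  simpa using hf.group hm r (r * (h - 1)) 0 (by omega)
    (Nat.mul_le_mul_left _ (by omega)) (by omega) (g := 1) (by simp [weightIdeal_zero])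

/-- The leading principal minor of size `τ`. -/
noncomputable def leadMinor (k : Type*) [Field k] {p τ : ℕ} (h : τ ≤ p) :
    MvPolynomial (Idx p) k :=
  minor k (Fin.castLE h) (Fin.castLE h)

lemma leadMinor_pow_mul_minor_mem (h : τ ≤ p) {s : ℕ} (a b : Fin s → Fin p) :
    leadMinor k h ^ s * minor k a b ∈ detIdeal k p (τ + 1) ^ (s - τ) := by
  let base : Fin τ → Fin p := Fin.castLE h
  let N (i l : Fin p) : Matrix (Fin (τ + 1)) (Fin (τ + 1)) (MvPolynomial (Idx p) k) :=
    (symMat k p).submatrix (Fin.cons i base) (Fin.cons l base)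
  let c (i : Fin p) (j : Fin τ) : MvPolynomial (Idx p) k :=
    -((-1) ^ (j.succ : ℕ) *
      minor k ((Fin.cons i base : Fin (τ + 1) → Fin p) ∘ j.succ.succAbove) base)
  have hN : ∀ i l, (N i l).det ∈ detIdeal k p (τ + 1) := by
    intro i l
    by_cases hi : i ∈ Set.range base
    · obtain ⟨j, rfl⟩ := hi
      rw [Matrix.det_zero_of_row_eq (i := 0) (j := j.succ) (Fin.succ_ne_zero j).symm]
      · exact Ideal.zero_mem _
      · ext x; simp [N]
    by_cases hl : l ∈ Set.range base
    · obtain ⟨j, rfl⟩ := hl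
      rw [Matrix.det_zero_of_column_eq (i := 0) (j := j.succ) (Fin.succ_ne_zero j).symm]
      · exact Ideal.zero_mem _
      · intro x; simp [N]
    · have hb : Function.Injective base := Fin.castLE_injective h
      exact minor_mem_detIdeal (Fin.cons_injective_iff.2 ⟨hi, hb⟩)
        (Fin.cons_injective_iff.2 ⟨hl, hb⟩)
  have key : ∀ i l, leadMinor k h * symMat k p i l =
      ∑ j, c i j * symMat k p (base j) l + (N i l).det := by
    intro i l
    rw [Matrix.det_succ_column_zero, Fin.sum_univ_succ, ← add_assoc, add_right_comm,
      ← Finset.sum_add_distrib, Finset.sum_eq_zero, zero_add]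
    · simp [N, leadMinor, minor, base, Matrix.submatrix_submatrix, mul_comm]
    · intro j _
      simp only [c, N, minor, Matrix.submatrix_apply, Fin.cons_succ, Fin.cons_zero,
        Matrix.submatrix_submatrix]
      have : (Fin.cons l base : Fin (τ + 1) → Fin p) ∘ Fin.succ = base := rfl
      rw [this]
      ring
  have e : leadMinor k h ^ s * minor k a b = Matrix.det (Matrix.of fun q l =>
      ∑ j, c (a q) j * symMat k p (base j) (b l) + (N (a q) (b l)).det) := by
    simp only [← key]
    rw [minor]
    have := Matrix.det_smul ((symMat k p).submatrix a b) (leadMinor k h)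
    rw [Fintype.card_fin] at this
    exact this.symm
  rw [e]
  simpa using det_mem_pow (fun q j => c (a q) j) (fun j l => symMat k p (base j) (b l))
    (fun q l => (N (a q) (b l)).det) (detIdeal k p (τ + 1)) fun q l => hN _ _

lemma MinorProd.exists_pow_mul_mem (h : τ ≤ p) {n : ℕ} {f : MvPolynomial (Idx p) k}
    (hf : MinorProd k p τ n f) :
    ∃ N, leadMinor k h ^ N * f ∈ detIdeal k p (τ + 1) ^ n := by
  induction hf with
  | one => exact ⟨0, by simp⟩
  | @mul s n f a b ha hb hf ih =>
    obtain ⟨N, hN⟩ := ih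
    refine ⟨N + s, ?_⟩
    have := Ideal.mul_mem_mul hN (leadMinor_pow_mul_minor_mem h a b)
    rw [← pow_add] at this
    convert this using 1
    ring

lemma leadMinor_notMem (h : τ ≤ p) : leadMinor k h ∉ detIdeal k p (τ + 1) := by
  let v : Idx p → k := fun x => if x.1.1 = x.1.2 ∧ (x.1.1 : ℕ) < τ then 1 else 0
  have hv : ∀ i j : Fin p, eval v (symMat k p i j) = if i = j ∧ (i : ℕ) < τ then 1 else 0 := by
    intro i j
    simp only [symMat, Matrix.of_apply, eval_X, v]
    rcases le_total i j with hij | hij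
    · simp [hij]
    · simp only [min_eq_right hij, max_eq_left hij]
      refine if_congr ?_ rfl rfl
      constructor <;> (rintro ⟨rfl, h⟩; exact ⟨rfl, h⟩)
  have hdet : ∀ {s : ℕ} (a b : Fin s → Fin p), eval v (minor k a b) =
      Matrix.det (Matrix.of fun q l => if a q = b l ∧ (a q : ℕ) < τ then (1 : k) else 0) := by
    intro s a b
    rw [minor, RingHom.map_det]
    congr 1
    ext q l
    simp [hv]
  intro hmem
  have hle : detIdeal k p (τ + 1) ≤ RingHom.ker (eval v) := by
    refine detIdeal_le fun a b ha _ => ?_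
    rw [RingHom.mem_ker, hdet]
    obtain ⟨q, hq⟩ : ∃ q, τ ≤ (a q : ℕ) := by
      by_contra! hcon
      have := Fintype.card_le_of_injective (fun q => (⟨a q, hcon q⟩ : Fin τ))
        fun x y hxy => ha (Fin.ext (by simpa using hxy))
      simp at this
    refine Matrix.det_eq_zero_of_row_eq_zero q fun l => ?_
    simp [hq]
  have h0 := hle hmem
  rw [RingHom.mem_ker, leadMinor, hdet] at h0
  have : (Matrix.of fun q l : Fin τ => if Fin.castLE h q = Fin.castLE h l ∧
      (Fin.castLE h q : ℕ) < τ then (1 : k) else 0) = 1 := by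
    ext q l
    simp [Matrix.one_apply]
  rw [this, Matrix.det_one] at h0
  exact one_ne_zero h0

/-- The containment follows once symbolic powers are described by a valuation-like criterion. -/
theorem containment_of_valuation {S : Type*} [CommRing S] [IsDomain S]
    (φ : MvPolynomial (Idx p) k →+* S)
    {u : S} (hu : Prime u) (hτ : τ < p)
    (hminor : ∀ {s : ℕ} (a b : Fin s → Fin p), u ^ (s - τ) ∣ φ (minor k a b))
    (hval : ∀ N f, u ^ N ∣ φ f → f ∈ weightIdeal k p τ N)
    {h m r : ℕ} (hm : 1 ≤ m) (hh : p - τ ≤ h) :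
    symbolicPower (detIdeal k p (τ + 1)) (r * (h + m - 1)) ≤
      varIdeal k p ^ (r * (h - 1)) * symbolicPower (detIdeal k p (τ + 1)) m ^ r := by
  set I := detIdeal k p (τ + 1) with hI
  have hIeq : I = Ideal.comap φ (Ideal.span {u}) := by
    refine le_antisymm (detIdeal_le fun a b _ _ => ?_) fun f hf => ?_
    · rw [Ideal.mem_comap, Ideal.mem_span_singleton]
      simpa using hminor a b
    · rw [Ideal.mem_comap, Ideal.mem_span_singleton] at hf
      exact weightIdeal_one_le (hval 1 f (by simpa using hf))
  have hprime : I.IsPrime := by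
    rw [hIeq]
    have := (Ideal.span_singleton_prime hu.ne_zero).2 hu
    exact Ideal.comap_isPrime _ _
  have hpow : ∀ n, ∀ f ∈ I ^ n, u ^ n ∣ φ f := by
    intro n f hf
    rw [← Ideal.mem_span_singleton, ← Ideal.span_singleton_pow]
    have : Ideal.map φ (I ^ n) ≤ Ideal.span {u} ^ n := by
      rw [Ideal.map_pow]
      refine Ideal.pow_right_mono ?_ n
      rw [Ideal.map_le_iff_le_comap, ← hIeq]
    exact this (Ideal.mem_map_of_mem φ hf)
  have hassoc : associatedPrimes (MvPolynomial (Idx p) k) (MvPolynomial (Idx p) k ⧸ I) = {I} := by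
    rw [associatedPrimes.eq_singleton_of_isPrimary hprime.isPrimary, hprime.radical]
  have h1 : ∀ N, symbolicPower I N ≤ weightIdeal k p τ N := by
    intro N f hf
    obtain ⟨s, hs, hsf⟩ := hf I (by rw [hassoc]; rfl)
    refine hval N f ?_
    have h2 := hpow N _ hsf
    rw [map_mul] at h2
    refine hu.pow_dvd_of_dvd_mul_left N (fun h3 => hs ?_) h2
    rw [hIeq, Ideal.mem_comap, Ideal.mem_span_singleton]
    exact h3
  have h2 : ∀ N, weightIdeal k p τ N ≤ symbolicPower I N := by
    intro N
    rw [weightIdeal, Ideal.span_le]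
    rintro f ⟨n, hn, hf⟩ P hP
    rw [hassoc, Set.mem_singleton_iff] at hP
    subst hP
    obtain ⟨M, hM⟩ := hf.exists_pow_mul_mem hτ.le
    exact ⟨_, fun h => leadMinor_notMem hτ.le (hprime.mem_of_pow_mem _ h),
      Ideal.pow_le_pow_right hn hM⟩
  exact (h1 _).trans ((weightIdeal_le_mul_pow hm hh (by omega)).trans
    (Ideal.mul_mono_right (Ideal.pow_right_mono (h2 m) r)))

end

section

/-- The index type of the entries of a generic `p × q` matrix. The order makes the last entry of
the last row the smallest index, hence the lexicographically largest variable. -/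
abbrev Var (p q : ℕ) : Type := (Fin p ×ₗ Fin q)ᵒᵈ

/-- The index of the entry in row `r` and column `c`. -/
def var {p q : ℕ} (r : Fin p) (c : Fin q) : Var p q := OrderDual.toDual (toLex (r, c))

lemma var_inj {p q : ℕ} {r r' : Fin p} {c c' : Fin q} :
    var r c = var r' c' ↔ r = r' ∧ c = c' := by
  simp [var]

lemma var_lt {p q : ℕ} {r r' : Fin p} {c c' : Fin q} :
    var r c < var r' c' ↔ r' < r ∨ r' = r ∧ c' < c := by
  rw [var, var, OrderDual.toDual_lt_toDual, Prod.Lex.toLex_lt_toLex]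

lemma var_cases {p q : ℕ} {P : Var p q → Prop} (h : ∀ r c, P (var r c)) (x : Var p q) : P x :=
  h x.1 x.2

section Scale

variable {A B : Type*} [CommRing A] [CommRing B] {q : ℕ}

/-- Substitute multiples of variables for the variables. -/
noncomputable def subst (φ : A →+* B) (g : Fin q → B) (π : Fin q → Fin q) :
    MvPolynomial (Fin q) A →+* MvPolynomial (Fin q) B :=
  eval₂Hom (C.comp φ) fun c => C (g c) * X (π c)

lemma subst_C (φ : A →+* B) (g : Fin q → B) (π : Fin q → Fin q) (a : A) :
    subst φ g π (C a) = C (φ a) := by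
  simp [subst]

lemma subst_X (φ : A →+* B) (g : Fin q → B) (π : Fin q → Fin q) (c : Fin q) :
    subst φ g π (X c) = C (g c) * X (π c) := by
  simp [subst]

lemma subst_monomial (φ : A →+* B) (g : Fin q → B) (π : Fin q → Fin q) (α : Fin q →₀ ℕ) (a : A) :
    subst φ g π (monomial α a) = monomial (α.mapDomain π) (φ a * ∏ c, g c ^ α c) := by
  have h1 : (∏ c, (X (π c) : MvPolynomial (Fin q) B) ^ α c) = monomial (α.mapDomain π) 1 := by
    rw [Finsupp.mapDomain, Finsupp.sum_fintype _ _ (by simp), monomial_sum_one]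
    simp [X_pow_eq_monomial]
  rw [subst, coe_eval₂Hom, eval₂_monomial, Finsupp.prod_fintype _ _ (by simp)]
  simp only [mul_pow, Finset.prod_mul_distrib, h1]
  rw [RingHom.comp_apply, ← mul_assoc]
  simp only [← map_pow, ← map_prod, ← map_mul]
  rw [C_mul_monomial, mul_one]

lemma coeff_subst_id (φ : A →+* B) (g : Fin q → B) (α : Fin q →₀ ℕ) (F : MvPolynomial (Fin q) A) :
    coeff α (subst φ g id F) = φ (coeff α F) * ∏ c, g c ^ α c := by
  induction F using MvPolynomial.induction_on' with
  | monomial β a =>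
    rw [subst_monomial, Finsupp.mapDomain_id, coeff_monomial, coeff_monomial]
    split_ifs with h
    · rw [h]
    · simp
  | add F G hF hG => simp [hF, hG, add_mul]

end Scale

variable {k : Type*} [Field k] {p q : ℕ}

/-- The coefficient ring: polynomials in the entries of a generic `p × q` matrix `M`. -/
abbrev Coeff (k : Type*) [Field k] (p q : ℕ) : Type _ := MvPolynomial (Var p q) k

/-- The substitution `Y = M D Mᵀ` with `M` a generic `p × q` matrix and `D` generic diagonal. -/
noncomputable def gram (k : Type*) [Field k] (p q : ℕ) :
    MvPolynomial (Idx p) k →+* MvPolynomial (Fin q) (Coeff k p q) :=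
  eval₂Hom (C.comp C) fun ij => ∑ c, C (X (var ij.1.1 c) * X (var ij.1.2 c)) * X c

lemma gram_symMat (i j : Fin p) :
    gram k p q (symMat k p i j) = ∑ c, C (X (var i c) * X (var j c)) * X c := by
  simp only [gram, symMat, Matrix.of_apply, coe_eval₂Hom, eval₂_X]
  rcases le_total i j with h | h
  · simp [h]
  · simp [h, mul_comm (X (var j _))]

/-- With one column for each pair of row indices, the substitution `Y = M D Mᵀ` is injective. -/
lemma gram_injective (ε : Fin q ≃ Idx p) : Function.Injective (gram k p q) := by
  classical
  let M : Fin p → Idx p → MvPolynomial (Idx p) k := fun i w =>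
    if i = w.1.1 ∨ i = w.1.2 then 1 else 0
  let d : Idx p → MvPolynomial (Idx p) k := fun w => if w.1.1 = w.1.2 then
    X w - ∑ w' : Idx p with w'.1.1 ≠ w'.1.2, M w.1.1 w' * X w' else X w
  let ψ : MvPolynomial (Fin q) (Coeff k p q) →+* MvPolynomial (Idx p) k :=
    eval₂Hom (eval₂Hom C fun x => M x.1 (ε x.2)) fun c => d (ε c)
  have hid : ψ.comp (gram k p q) = RingHom.id _ := by
    refine MvPolynomial.ringHom_ext (fun a => by simp [ψ, gram]) fun ij => ?_
    have e1 : ψ (gram k p q (X ij)) = ∑ w, M ij.1.1 w * M ij.1.2 w * d w := by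
      rw [← ε.sum_comp]
      simp only [ψ, gram, coe_eval₂Hom, eval₂_X, eval₂_sum, eval₂_mul, eval₂_C]
      rfl
    rw [RingHom.comp_apply, e1, RingHom.id_apply]
    obtain ⟨⟨i, j⟩, hij⟩ := ij
    rcases eq_or_ne i j with rfl | hne
    · rw [← Finset.sum_filter_add_sum_filter_not univ (fun w : Idx p => w.1.1 ≠ w.1.2)]
      rw [Finset.sum_eq_single_of_mem (s := univ.filter fun w : Idx p => ¬ w.1.1 ≠ w.1.2)
        ⟨(i, i), hij⟩ (by simp)]
      · have : ∀ w ∈ univ.filter (fun w : Idx p => w.1.1 ≠ w.1.2),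
            M i w * M i w * d w = M i w * X w := by
          intro w hw
          have hw : w.1.1 ≠ w.1.2 := by simpa using hw
          simp only [M, d, hw, if_false]
          split_ifs <;> simp
        rw [Finset.sum_congr rfl this]
        simp [d, M]
      · rintro ⟨⟨a, b⟩, hab⟩ hw hne
        obtain rfl : a = b := by simpa using hw
        have : i ≠ a := by rintro rfl; exact hne rfl
        simp [M, this]
    · have hlt : i < j := lt_of_le_of_ne hij hne
      rw [Finset.sum_eq_single_of_mem ⟨(i, j), hij⟩ (Finset.mem_univ _)]
      · simp [M, d, hne]
      · rintro ⟨⟨a, b⟩, hab⟩ - hw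
        have hw : ¬ (a = i ∧ b = j) := by
          rintro ⟨rfl, rfl⟩; exact hw rfl
        have hab : a ≤ b := hab
        simp only [M]
        by_cases h1 : i = a ∨ i = b
        · rw [if_neg (show ¬ (j = a ∨ j = b) by omega)]
          simp
        · simp [h1]
  intro f g hfg
  have := congrArg ψ hfg
  rwa [← RingHom.comp_apply, ← RingHom.comp_apply, hid] at this

/-- The part of the exponent `α` beyond the first `τ` entries. -/
def tail (τ : ℕ) (α : Fin q →₀ ℕ) : ℕ := ∑ c : Fin q, if (c : ℕ) < τ then 0 else α c

lemma tail_add (τ : ℕ) (α β : Fin q →₀ ℕ) : tail τ (α + β) = tail τ α + tail τ β := by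
  simp only [tail, ← Finset.sum_add_distrib]
  refine Finset.sum_congr rfl fun c _ => ?_
  split_ifs <;> simp

/-- The substitution `Y = M D Mᵀ` with all but the first `τ` diagonal entries scaled by a new
variable. -/
noncomputable def gramScaled (k : Type*) [Field k] (p q τ : ℕ) :
    MvPolynomial (Idx p) k →+* MvPolynomial (Fin q) (Polynomial (Coeff k p q)) :=
  (subst Polynomial.C (fun c => if (c : ℕ) < τ then 1 else Polynomial.X) id).comp (gram k p q)

/-- The scaling variable of `gramScaled`. -/
noncomputable def scaleVar (k : Type*) [Field k] (p q : ℕ) :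
    MvPolynomial (Fin q) (Polynomial (Coeff k p q)) :=
  C Polynomial.X

lemma scaleVar_prime : Prime (scaleVar k p q) := by
  rw [scaleVar, prime_C_iff]
  exact Polynomial.prime_X

lemma le_tail_of_dvd {τ N : ℕ} {f : MvPolynomial (Idx p) k}
    (h : scaleVar k p q ^ N ∣ gramScaled k p q τ f) {α : Fin q →₀ ℕ}
    (hα : coeff α (gram k p q f) ≠ 0) : N ≤ tail τ α := by
  rw [scaleVar, ← map_pow, C_dvd_iff_dvd_coeff] at h
  have h1 := h α
  rw [gramScaled, RingHom.comp_apply, coeff_subst_id] at h1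
  have h2 : ∏ c : Fin q, (if (c : ℕ) < τ then 1 else Polynomial.X : Polynomial (Coeff k p q)) ^ α c
      = Polynomial.X ^ tail τ α := by
    rw [tail, ← Finset.prod_pow_eq_pow_sum]
    refine Finset.prod_congr rfl fun c _ => ?_
    split_ifs <;> simp
  rw [h2, Polynomial.X_pow_dvd_iff] at h1
  by_contra! hlt
  exact hα (by simpa using h1 _ hlt)

lemma map_minor {S : Type*} [CommRing S] (φ : MvPolynomial (Idx p) k →+* S) {s : ℕ}
    (a b : Fin s → Fin p) :
    φ (minor k a b) = Matrix.det (Matrix.of fun x l => φ (symMat k p (a x) (b l))) := by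
  rw [minor, RingHom.map_det]
  rfl

lemma pow_dvd_map_minor {S κ : Type*} [CommRing S] [Fintype κ]
    (φ : MvPolynomial (Idx p) k →+* S) (u : S) (x y : Fin p → κ → S) (w : Fin p → Fin p → S)
    (h : ∀ i j, φ (symMat k p i j) = ∑ c, x i c * y j c + u * w i j) {s : ℕ}
    (a b : Fin s → Fin p) : u ^ (s - Fintype.card κ) ∣ φ (minor k a b) := by
  rw [← Ideal.mem_span_singleton, ← Ideal.span_singleton_pow, map_minor]
  simp only [h]
  exact det_mem_pow (fun i c => x (a i) c) (fun c l => y (b l) c) (fun i l => u * w (a i) (b l)) _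
    fun _ _ => Ideal.mul_mem_right _ _ (Ideal.mem_span_singleton_self _)

lemma gramScaled_symMat (τ : ℕ) (i j : Fin p) : gramScaled k p q τ (symMat k p i j) =
    ∑ c : {c : Fin q // (c : ℕ) < τ}, (C (Polynomial.C (X (var i c.1)))) *
      (C (Polynomial.C (X (var j c.1))) * X c.1) +
    scaleVar k p q * ∑ c : {c : Fin q // ¬ (c : ℕ) < τ},
      C (Polynomial.C (X (var i c.1) * X (var j c.1))) * X c.1 := by
  rw [gramScaled, RingHom.comp_apply, gram_symMat, map_sum,
    ← Fintype.sum_subtype_add_sum_subtype (fun c : Fin q => (c : ℕ) < τ), Finset.mul_sum]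
  congr 1
  · refine Finset.sum_congr rfl fun c _ => ?_
    rw [map_mul, subst_C, subst_X, if_pos c.2]
    simp [mul_assoc]
  · refine Finset.sum_congr rfl fun c _ => ?_
    rw [map_mul, subst_C, subst_X, if_neg c.2]
    simp only [scaleVar, id]
    ring

lemma scaleVar_dvd_minor (τ : ℕ) {s : ℕ} (a b : Fin s → Fin p) :
    scaleVar k p q ^ (s - τ) ∣ gramScaled k p q τ (minor k a b) := by
  have hκ : Fintype.card {c : Fin q // (c : ℕ) < τ} ≤ τ := by
    have := Fintype.card_le_of_injective
      (fun c : {c : Fin q // (c : ℕ) < τ} => (⟨c.1, c.2⟩ : Fin τ))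
      fun x y hxy => Subtype.ext (Fin.ext (by simpa using hxy))
    simpa using this
  have h := pow_dvd_map_minor (S := MvPolynomial (Fin q) (Polynomial (Coeff k p q)))
    (gramScaled k p q τ) (scaleVar k p q)
    (fun i (c : {c : Fin q // (c : ℕ) < τ}) => C (Polynomial.C (X (var i c.1))))
    (fun j c => C (Polynomial.C (X (var j c.1))) * X c.1) _ (gramScaled_symMat τ) a b
  exact (pow_dvd_pow _ (Nat.sub_le_sub_left hκ s)).trans h

lemma scaleVar_dvd_of_mem {τ N : ℕ} {f : MvPolynomial (Idx p) k}
    (hf : f ∈ weightIdeal k p τ N) : scaleVar k p q ^ N ∣ gramScaled k p q τ f := by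
  have : weightIdeal k p τ N ≤
      Ideal.comap (gramScaled k p q τ) (Ideal.span {scaleVar k p q ^ N}) := by
    rw [weightIdeal, Ideal.span_le]
    rintro f ⟨n, hn, hf⟩
    change gramScaled k p q τ f ∈ Ideal.span _
    rw [Ideal.mem_span_singleton]
    refine (pow_dvd_pow _ hn).trans ?_
    clear hn
    induction hf with
    | one => simp
    | mul a b _ _ _ ih =>
      rw [map_mul, add_comm, pow_add]
      exact mul_dvd_mul (scaleVar_dvd_minor τ a b) ih
  exact Ideal.mem_span_singleton.1 (this hf)

end

section

variable {k : Type*} [Field k] {p q : ℕ}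

/-- The degree of an exponent in the variables of column `c`. -/
def colSum (e : Var p q →₀ ℕ) (c : Fin q) : ℕ := ∑ r, e (var r c)

/-- The coefficient of `α` is homogeneous of degree `2 * α c` in the variables of each column. -/
def ColHom (F : MvPolynomial (Fin q) (Coeff k p q)) : Prop :=
  ∀ α e, coeff e (coeff α F) ≠ 0 → ∀ c, colSum e c = 2 * α c

lemma ColHom.add {F G : MvPolynomial (Fin q) (Coeff k p q)} (hF : ColHom F) (hG : ColHom G) :
    ColHom (F + G) := by
  intro α e h c
  rw [coeff_add, coeff_add] at h
  rcases ne_or_eq (coeff e (coeff α F)) 0 with h1 | h1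
  · exact hF α e h1 c
  · exact hG α e (by simpa [h1] using h) c

lemma ColHom.mul {F G : MvPolynomial (Fin q) (Coeff k p q)} (hF : ColHom F) (hG : ColHom G) :
    ColHom (F * G) := by
  classical
  intro α e h c
  rw [coeff_mul, coeff_sum] at h
  obtain ⟨⟨α₁, α₂⟩, hα, h⟩ := Finset.exists_ne_zero_of_sum_ne_zero h
  rw [coeff_mul] at h
  obtain ⟨⟨e₁, e₂⟩, he, h⟩ := Finset.exists_ne_zero_of_sum_ne_zero h
  have h1 := hF α₁ e₁ (left_ne_zero_of_mul h) c
  have h2 := hG α₂ e₂ (right_ne_zero_of_mul h) c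
  rw [HasAntidiagonal.mem_antidiagonal] at hα he
  subst hα he
  simp only [colSum, Finsupp.add_apply, Finset.sum_add_distrib] at h1 h2 ⊢
  omega

lemma colHom_zero : ColHom (0 : MvPolynomial (Fin q) (Coeff k p q)) := by
  intro α e h
  simp at h

lemma colSum_single (r : Fin p) (c c' : Fin q) (n : ℕ) :
    colSum (Finsupp.single (var r c) n) c' = if c = c' then n else 0 := by
  classical
  simp only [colSum, Finsupp.single_apply, var_inj]
  by_cases h : c = c' <;> simp [h]

lemma colSum_add (e e' : Var p q →₀ ℕ) (c : Fin q) :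
    colSum (e + e') c = colSum e c + colSum e' c := by
  simp [colSum, Finset.sum_add_distrib]

lemma gram_colHom (f : MvPolynomial (Idx p) k) : ColHom (gram k p q f) := by
  classical
  induction f using MvPolynomial.induction_on with
  | C a =>
    intro α e h c
    simp only [gram, coe_eval₂Hom, eval₂_C, RingHom.comp_apply, coeff_C] at h
    split_ifs at h with h1
    · rw [coeff_C] at h
      split_ifs at h with h2
      · simp [← h1, ← h2, colSum]
      · exact absurd rfl h
    · simp at h
  | add f g hf hg => simpa using hf.add hg
  | mul_X f ij hf =>
    rw [map_mul]
    refine hf.mul ?_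
    simp only [gram, coe_eval₂Hom, eval₂_X]
    refine Finset.sum_induction _ ColHom (fun _ _ => ColHom.add) colHom_zero fun c _ => ?_
    intro α e h c'
    rw [coeff_C_mul, coeff_X] at h
    split_ifs at h with h1
    · rw [mul_one, X, X, monomial_mul, coeff_monomial] at h
      split_ifs at h with h2
      · rw [← h2, ← h1, colSum_add, colSum_single, colSum_single, Finsupp.single_apply]
        split_ifs <;> rfl
      · exact absurd rfl h
    · simp at h

/-- The column operation adding column `j` to column `j'`. -/
noncomputable def colAdd (j j' : Fin q) : Coeff k p q →+* Coeff k p q :=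
  eval₂Hom C fun x => if x.2 = j' then X x + X (var x.1 j) else X x

/-- A one-parameter family of column operations on columns `j` and `j'`, with value `colAdd` at
the origin. -/
noncomputable def colFamily (j j' : Fin q) : Coeff k p q →+* Polynomial (Coeff k p q) :=
  eval₂Hom (Polynomial.C.comp C) fun x =>
    if x.2 = j' then Polynomial.C (X x + X (var x.1 j))
    else if x.2 = j then Polynomial.C (X x) - Polynomial.X * Polynomial.C (X (var x.1 j'))
    else Polynomial.C (X x)

lemma coeff_zero_colFamily (j j' : Fin q) (a : Coeff k p q) :
    (colFamily j j' a).coeff 0 = colAdd j j' a := by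
  rw [Polynomial.coeff_zero_eq_eval_zero]
  have : (Polynomial.evalRingHom 0).comp (colFamily j j') = colAdd (k := k) (p := p) j j' := by
    refine MvPolynomial.ringHom_ext (fun r => by simp [colFamily, colAdd]) fun x => ?_
    simp only [colFamily, colAdd, RingHom.comp_apply, coe_eval₂Hom, eval₂_X]
    split_ifs <;> simp
  exact RingHom.congr_fun this a

/-- Merge the index `j'` into `j`. -/
def merge {σ : Type*} [DecidableEq σ] (j j' c : σ) : σ := if c = j' then j else c

lemma colFamily_X (j j' : Fin q) (r : Fin p) (c : Fin q) :
    colFamily (k := k) j j' (X (var r c)) =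
      if c = j' then Polynomial.C (X (var r c)) + Polynomial.C (X (var r j))
      else if c = j then Polynomial.C (X (var r c)) - Polynomial.X * Polynomial.C (X (var r j'))
      else Polynomial.C (X (var r c)) := by
  simp only [colFamily, coe_eval₂Hom, eval₂_X, ← map_add]
  rfl

lemma two_column_identity {B : Type*} [CommRing B] (x x' y y' ρ : B)
    (Z : MvPolynomial (Fin q) B) :
    C x * C x' * (C (1 + ρ) * Z) + C y * C y' * (C (ρ * (1 + ρ)) * Z) =
      C (x - ρ * y) * C (x' - ρ * y') * (C 1 * Z) + C (y + x) * C (y' + x') * (C ρ * Z) := by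
  simp only [map_add, map_sub, map_mul, map_one]
  ring

lemma subst_gram_C {B : Type*} [CommRing B] (φ : Coeff k p q →+* B) (g : Fin q → B)
    (π : Fin q → Fin q) (a : k) : subst φ g π (gram k p q (C a)) = C (φ (C a)) := by
  simp [gram, subst_C]

lemma subst_gram_X {B : Type*} [CommRing B] (φ : Coeff k p q →+* B) (g : Fin q → B)
    (π : Fin q → Fin q) (ij : Idx p) : subst φ g π (gram k p q (X ij)) =
      ∑ c, C (φ (X (var ij.1.1 c))) * C (φ (X (var ij.1.2 c))) * (C (g c) * X (π c)) := by
  simp only [gram, coe_eval₂Hom, eval₂_X, map_sum, map_mul, subst_C, subst_X]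

lemma sum_eq_sum_of_pair {B : Type*} [AddCommMonoid B] {j j' : Fin q} (hj : j ≠ j')
    {f g : Fin q → B} (h : f j + f j' = g j + g j')
    (h' : ∀ c, c ≠ j → c ≠ j' → f c = g c) : ∑ c, f c = ∑ c, g c := by
  have hmem : j' ∈ univ.erase j := Finset.mem_erase.2 ⟨hj.symm, Finset.mem_univ j'⟩
  rw [← Finset.add_sum_erase _ f (Finset.mem_univ j), ← Finset.add_sum_erase _ f hmem,
    ← Finset.add_sum_erase _ g (Finset.mem_univ j), ← Finset.add_sum_erase _ g hmem,
    ← add_assoc, ← add_assoc, h]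
  refine congrArg _ (Finset.sum_congr rfl fun c hc => h' c ?_ ?_) <;>
  · rintro rfl; simp at hc

lemma gram_merge {j j' : Fin q} (hj : j ≠ j') (f : MvPolynomial (Idx p) k) :
    subst Polynomial.C (fun c => if c = j' then Polynomial.X * (1 + Polynomial.X)
      else if c = j then 1 + Polynomial.X else 1) (merge j j') (gram k p q f) =
    subst (colFamily j j') (fun c => if c = j' then Polynomial.X else 1) (merge j j')
      (gram k p q f) := by
  rw [← RingHom.comp_apply, ← RingHom.comp_apply]
  refine RingHom.congr_fun (MvPolynomial.ringHom_ext (fun a => ?_) fun ij => ?_) f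
  · rw [RingHom.comp_apply, RingHom.comp_apply, subst_gram_C, subst_gram_C]
    simp [colFamily]
  · rw [RingHom.comp_apply, RingHom.comp_apply, subst_gram_X, subst_gram_X]
    simp only [colFamily_X]
    refine sum_eq_sum_of_pair hj ?_ fun c h1 h2 => ?_
    · simp only [merge, if_true, if_neg hj]
      exact two_column_identity _ _ _ _ _ _
    · simp only [merge, if_neg h1, if_neg h2]

end

section

variable {k : Type*} [Field k] {p q : ℕ}

lemma mapDomain_merge_apply {σ : Type*} [Fintype σ] [DecidableEq σ] {j j' : σ} (hj : j ≠ j')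
    (α : σ →₀ ℕ) :
    α.mapDomain (merge j j') j = α j + α j' := by
  classical
  rw [Finsupp.mapDomain, Finsupp.sum_fintype _ _ (by simp), Finsupp.finsetSum_apply]
  simp only [Finsupp.single_apply]
  rw [Finset.sum_eq_add j j' hj]
  · simp [merge]
  · rintro c - ⟨h1, h2⟩
    simp [merge, h1, h2]
  · simp
  · simp

lemma mapDomain_merge_apply_of_ne {σ : Type*} [Fintype σ] [DecidableEq σ] {j j' c : σ}
    (hc : c ≠ j) (hc' : c ≠ j') (α : σ →₀ ℕ) : α.mapDomain (merge j j') c = α c := by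
  classical
  rw [Finsupp.mapDomain, Finsupp.sum_fintype _ _ (by simp), Finsupp.finsetSum_apply]
  simp only [Finsupp.single_apply]
  rw [Finset.sum_eq_single c]
  · simp [merge, hc']
  · intro b _ hb
    rw [if_neg]
    unfold merge
    split_ifs
    · exact hc.symm
    · exact hb
  · simp

lemma eq_of_mapDomain_merge {j j' : Fin q} (hj : j ≠ j') {α β : Fin q →₀ ℕ}
    (h : α.mapDomain (merge j j') = β.mapDomain (merge j j')) :
    α j + α j' = β j + β j' ∧ ∀ c, c ≠ j → c ≠ j' → α c = β c := by
  refine ⟨?_, fun c hc hc' => ?_⟩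
  · simpa [mapDomain_merge_apply hj] using DFunLike.congr_fun h j
  · simpa [mapDomain_merge_apply_of_ne hc hc'] using DFunLike.congr_fun h c

lemma lex_le_apply {σ : Type*} [LinearOrder σ] [WellFoundedGT σ] {α β : σ →₀ ℕ}
    (h : β ≼[MonomialOrder.lex] α) (i : σ) (hi : ∀ x < i, β x = α x) : β i ≤ α i := by
  rw [MonomialOrder.lex_le_iff, le_iff_lt_or_eq] at h
  rcases h with h | h
  · obtain ⟨x, hx, hlt⟩ := Finsupp.Lex.lt_iff.1 h
    rcases lt_trichotomy x i with hxi | rfl | hxi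
    · exact absurd (hi x hxi) hlt.ne
    · exact hlt.le
    · exact (hx i hxi).le
  · exact (DFunLike.congr_fun (toLex.injective h) i).le

/-- Extract the coefficient of `α` after merging the variables `j` and `j'`. -/
lemma coeff_subst_merge {B : Type*} [CommRing B] (φ : Coeff k p q →+* Polynomial B)
    (g : Fin q → Polynomial B) {j j' : Fin q} (hj : j < j')
    (hg : ∀ c, c ≠ j → c ≠ j' → g c = 1) (g' g'' : Polynomial B) (hg' : g j' = Polynomial.X * g')
    (hg'' : g j = g'') (h0' : g'.coeff 0 = 1) (h0'' : g''.coeff 0 = 1)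
    {F : MvPolynomial (Fin q) (Coeff k p q)} {α : Fin q →₀ ℕ}
    (hα : MonomialOrder.lex.degree F ≼[MonomialOrder.lex] α) :
    (coeff (α.mapDomain (merge j j')) (subst φ g (merge j j') F)).coeff (α j') =
      (φ (coeff α F)).coeff 0 := by
  classical
  have hprod : ∀ β : Fin q →₀ ℕ, ∏ c, g c ^ β c =
      Polynomial.X ^ β j' * (g' ^ β j' * g'' ^ β j) := by
    intro β
    rw [Finset.prod_eq_mul j j' hj.ne, hg', hg'', mul_pow]
    · ring
    · rintro c - ⟨h1, h2⟩
      simp [hg c h1 h2]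
    · simp
    · simp
  conv_lhs => rw [F.as_sum, map_sum, coeff_sum, Polynomial.finsetSum_coeff]
  have hterm : ∀ β, β ≠ α → β ∈ F.support →
      (coeff (α.mapDomain (merge j j'))
        (subst φ g (merge j j') (monomial β (coeff β F)))).coeff (α j') = 0 := by
    intro β hne hβ
    rw [subst_monomial, coeff_monomial]
    split_ifs with h
    · obtain ⟨h1, h2⟩ := eq_of_mapDomain_merge hj.ne h
      have hle : β j ≤ α j := lex_le_apply ((MonomialOrder.le_degree hβ).trans hα) j
        fun x hx => h2 x hx.ne (hx.trans hj).ne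
      have hlt : α j' < β j' := by
        by_contra! hcon
        apply hne
        ext c
        by_cases hc : c = j
        · subst hc; omega
        by_cases hc' : c = j'
        · subst hc'; omega
        exact h2 c hc hc'
      rw [hprod, mul_left_comm, Polynomial.coeff_X_pow_mul', if_neg (by omega)]
    · simp
  by_cases hmem : α ∈ F.support
  · rw [Finset.sum_eq_single_of_mem α hmem fun β hβ hne => hterm β hne hβ,
      subst_monomial, coeff_monomial, if_pos rfl, hprod, mul_left_comm,
      Polynomial.coeff_X_pow_mul', if_pos le_rfl]
    simp [Polynomial.coeff_zero_eq_eval_zero] at h0' h0'' ⊢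
    simp [h0', h0'']
  · rw [Finset.sum_eq_zero fun β hβ => hterm β (by rintro rfl; exact hmem hβ) hβ,
      notMem_support_iff.1 hmem]
    simp

/-- The leading coefficient of `gram f` is invariant under column operations. -/
lemma colAdd_coeff_gram {j j' : Fin q} (hj : j < j') {f : MvPolynomial (Idx p) k}
    {α : Fin q →₀ ℕ} (hα : MonomialOrder.lex.degree (gram k p q f) ≼[MonomialOrder.lex] α) :
    colAdd j j' (coeff α (gram k p q f)) = coeff α (gram k p q f) := by
  have h1 := coeff_subst_merge (Polynomial.C : Coeff k p q →+* _)
    (fun c => if c = j' then Polynomial.X * (1 + Polynomial.X)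
      else if c = j then 1 + Polynomial.X else 1) hj (fun c h h' => by simp [h, h'])
    (1 + Polynomial.X) (1 + Polynomial.X) (by simp) (by simp [hj.ne]) (by simp) (by simp) hα
  have h2 := coeff_subst_merge (colFamily (k := k) (p := p) j j')
    (fun c => if c = j' then Polynomial.X else 1) hj (fun c h h' => by simp [h'])
    1 1 (by simp) (by simp [hj.ne]) (by simp) (by simp) hα
  rw [gram_merge hj.ne, h2] at h1
  rw [← coeff_zero_colFamily, h1, Polynomial.coeff_C_zero]

end

section

variable {k : Type*} [Field k] {p q : ℕ}

/-- The exponent of the product of the first `s` diagonal variables. -/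
noncomputable def initExp (q s : ℕ) : Fin q →₀ ℕ :=
  Finsupp.equivFunOnFinite.symm fun c => if (c : ℕ) < s then 1 else 0

lemma initExp_apply {s : ℕ} (c : Fin q) : initExp q s c = if (c : ℕ) < s then 1 else 0 := rfl

lemma sum_castLE {B : Type*} [AddCommMonoid B] {s : ℕ} (hs : s ≤ q) (f : Fin q → B)
    (hf : ∀ c : Fin q, ¬ (c : ℕ) < s → f c = 0) : ∑ c, f c = ∑ c : Fin s, f (Fin.castLE hs c) := by
  rw [← Finset.sum_subset (Finset.subset_univ (univ.map (Fin.castLEEmb hs))), Finset.sum_map]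
  · rfl
  · intro c _ hc
    refine hf c fun h => hc ?_
    simpa using ⟨⟨c, h⟩, rfl⟩

lemma sum_initExp {s : ℕ} (hs : s ≤ q) : ∑ c, initExp q s c = s := by
  rw [sum_castLE hs _ fun c hc => by simp [initExp_apply, hc]]
  simp [initExp_apply]

lemma le_initExp {s : ℕ} (hs : s ≤ q) {β : Fin q →₀ ℕ} (h1 : ∀ c, β c ≤ 1)
    (h : ∑ c, β c = s) : β ≼[MonomialOrder.lex] initExp q s := by
  rw [MonomialOrder.lex_le_iff]
  by_contra! hcon
  obtain ⟨i, hi, hlt⟩ := Finsupp.Lex.lt_iff.1 hcon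
  have hlt : initExp q s i < β i := hlt
  have hi : ∀ j < i, initExp q s j = β j := hi
  have : ∑ c, initExp q s c < ∑ c, β c := by
    refine Finset.sum_lt_sum (fun c _ => ?_) ⟨i, Finset.mem_univ i, hlt⟩
    rcases lt_trichotomy c i with hc | rfl | hc
    · exact (hi c hc).le
    · exact hlt.le
    · have h2 := h1 i
      rw [initExp_apply] at hlt ⊢
      have : ¬ (i : ℕ) < s := by
        intro h3; rw [if_pos h3] at hlt; omega
      rw [if_neg]
      · exact Nat.zero_le _
      · have : (i : ℕ) < c := hc
        omega
  rw [sum_initExp hs, h] at this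
  exact this.false

lemma degree_gram_minor {s : ℕ} (hs : s ≤ q) (a b : Fin s → Fin p) :
    MonomialOrder.lex.degree (gram k p q (minor k a b)) ≼[MonomialOrder.lex] initExp q s := by
  classical
  let v (κ : Fin s → Fin q) (x : Fin s) : MvPolynomial (Fin q) (Coeff k p q) :=
    C (X (var (a x) (κ x))) * X (κ x)
  let W (κ : Fin s → Fin q) : Matrix (Fin s) (Fin s) (Coeff k p q) :=
    Matrix.of fun x l => X (var (b l) (κ x))
  have hexp : gram k p q (minor k a b) = ∑ κ : Fin s → Fin q,
      monomial (∑ x, Finsupp.single (κ x) 1) ((∏ x, X (var (a x) (κ x))) * (W κ).det) := by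
    rw [map_minor]
    simp only [gram_symMat]
    have h1 := (Matrix.detRowAlternating (n := Fin s)
      (R := MvPolynomial (Fin q) (Coeff k p q))).toMultilinearMap.map_sum
      fun x c l => C (X (var (a x) c) * X (var (b l) c)) * X c
    have h2 : (Matrix.of fun x l => ∑ c, C (X (var (a x) c) * X (var (b l) c)) * X c :
        Matrix (Fin s) (Fin s) (MvPolynomial (Fin q) (Coeff k p q))) =
        fun x => ∑ c, fun l => C (X (var (a x) c) * X (var (b l) c)) * X c := by
      ext1 x l
      simp [Finset.sum_apply]
    rw [h2]
    refine h1.trans (Finset.sum_congr rfl fun κ _ => ?_)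
    have h3 : (Matrix.of fun x l => C (X (var (a x) (κ x)) * X (var (b l) (κ x))) * X (κ x) :
        Matrix (Fin s) (Fin s) (MvPolynomial (Fin q) (Coeff k p q))) =
        Matrix.of fun x l => v κ x * (C.mapMatrix (W κ)) x l := by
      ext1 x l
      simp only [v, W, Matrix.of_apply, RingHom.mapMatrix_apply, Matrix.map_apply, map_mul]
      ring
    refine (congrArg Matrix.det h3).trans ?_
    rw [Matrix.det_mul_column, ← RingHom.map_det, ← mul_one (_ * (W κ).det),
      ← C_mul_monomial, monomial_sum_one, map_mul, map_prod, mul_right_comm,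
      ← Finset.prod_mul_distrib]
    rfl
  rw [MonomialOrder.degree_le_iff]
  intro β hβ
  rw [hexp, mem_support_iff, coeff_sum] at hβ
  obtain ⟨κ, -, hκ⟩ := Finset.exists_ne_zero_of_sum_ne_zero hβ
  rw [coeff_monomial] at hκ
  split_ifs at hκ with h
  swap; · exact absurd rfl hκ
  have hinj : Function.Injective κ := by
    intro x x' hxx
    by_contra hne
    refine hκ ?_
    rw [Matrix.det_zero_of_row_eq hne (by ext l; simp [W, hxx]), mul_zero]
  subst h
  have happ : ∀ c, (∑ x, Finsupp.single (κ x) 1 : Fin q →₀ ℕ) c = #{x | κ x = c} := by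
    intro c
    simp [Finsupp.finsetSum_apply, Finsupp.single_apply]
  refine le_initExp hs (fun c => ?_) ?_
  · rw [happ, Finset.card_le_one]
    intro x hx x' hx'
    simp only [Finset.mem_filter_univ] at hx hx'
    exact hinj (hx.trans hx'.symm)
  · simp only [happ]
    rw [← Finset.card_eq_sum_card_fiberwise (fun x _ => by simp)]
    simp

/-- The determinant formed by the rows `a` and the first columns of the generic matrix. -/
noncomputable def colDet (k : Type*) [Field k] {p q s : ℕ} (hs : s ≤ q) (a : Fin s → Fin p) :
    Coeff k p q :=
  Matrix.det (Matrix.of fun x c => X (var (a x) (Fin.castLE hs c)))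

lemma coeff_gram_minor {s : ℕ} (hs : s ≤ q) (a b : Fin s → Fin p) :
    coeff (initExp q s) (gram k p q (minor k a b)) = colDet k hs a * colDet k hs b := by
  let g : Fin q → Coeff k p q := fun c => if (c : ℕ) < s then 1 else 0
  have h1 := coeff_subst_id (RingHom.id (Coeff k p q)) g (initExp q s)
    (gram k p q (minor k a b))
  have h2 : ∏ c, g c ^ initExp q s c = 1 := by
    refine Finset.prod_eq_one fun c _ => ?_
    simp only [g, initExp_apply]
    split_ifs <;> simp
  rw [h2, mul_one, RingHom.id_apply] at h1
  rw [← h1, ← RingHom.comp_apply, map_minor]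
  let A (a : Fin s → Fin p) : Matrix (Fin s) (Fin s) (Coeff k p q) :=
    Matrix.of fun x c => X (var (a x) (Fin.castLE hs c))
  have h3 : (Matrix.of fun x l => ((subst (RingHom.id (Coeff k p q)) g id).comp (gram k p q))
        (symMat k p (a x) (b l)) :
        Matrix (Fin s) (Fin s) (MvPolynomial (Fin q) (Coeff k p q))) =
      C.mapMatrix (A a) * Matrix.diagonal (fun c => X (Fin.castLE hs c)) *
        (C.mapMatrix (A b)).transpose := by
    ext1 x l
    rw [Matrix.mul_apply, Matrix.of_apply, RingHom.comp_apply, gram_symMat, map_sum,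
      sum_castLE hs]
    · refine Finset.sum_congr rfl fun c _ => ?_
      rw [map_mul, subst_C, subst_X, Matrix.mul_diagonal]
      simp [g, A]
      ring
    · intro c hc
      rw [map_mul, subst_X]
      simp [g, hc]
  rw [h3, Matrix.det_mul, Matrix.det_mul, Matrix.det_transpose, ← RingHom.map_det,
    ← RingHom.map_det, Matrix.det_diagonal]
  have h4 : (∏ c : Fin s, X (Fin.castLE hs c) : MvPolynomial (Fin q) (Coeff k p q)) =
      monomial (initExp q s) 1 := by
    have h5 : initExp q s = ∑ c : Fin s, Finsupp.single (Fin.castLE hs c) 1 := by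
      ext c
      have h6 := sum_castLE hs (fun d => if d = c ∧ (d : ℕ) < s then 1 else 0)
        (fun d hd => if_neg fun h => hd h.2)
      rw [initExp_apply, Finsupp.finsetSum_apply]
      simp only [Finsupp.single_apply]
      simpa [ite_and] using h6
    rw [h5, monomial_sum_one]
    rfl
  rw [h4, mul_right_comm, ← map_mul, coeff_C_mul, coeff_monomial, if_pos rfl, mul_one]
  rfl

/-- The exponent of the leading monomial of `colDet`. -/
noncomputable def colExp {s : ℕ} (hs : s ≤ q) (a : Fin s → Fin p) : Var p q →₀ ℕ :=
  ∑ x, Finsupp.single (var (a x) (Fin.castLE hs x)) 1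

lemma permExp_apply {s : ℕ} (hs : s ≤ q) (a : Fin s → Fin p) (σ : Equiv.Perm (Fin s)) (r : Fin p)
    (c : Fin q) :
    (∑ x, Finsupp.single (var (a x) (Fin.castLE hs (σ x))) 1 : Var p q →₀ ℕ) (var r c) =
      ∑ x, if a x = r ∧ Fin.castLE hs (σ x) = c then 1 else 0 := by
  classical
  simp only [Finsupp.finsetSum_apply, Finsupp.single_apply, var_inj]

lemma permExp_lt {s : ℕ} (hs : s ≤ q) {a : Fin s → Fin p} (ha : StrictMono a)
    {σ : Equiv.Perm (Fin s)} (hσ : σ ≠ 1) :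
    (∑ x, Finsupp.single (var (a x) (Fin.castLE hs (σ x))) 1) ≺[MonomialOrder.lex]
      colExp hs a := by
  classical
  obtain ⟨i, hi, hmax⟩ := (Set.toFinite {i | σ i ≠ i}).exists_maximal
    (by
      by_contra! h
      refine hσ (Equiv.ext fun x => ?_)
      by_contra hx
      exact (h ▸ (show x ∈ {i | σ i ≠ i} from hx) : x ∈ (∅ : Set (Fin s))))
  have hfix : ∀ x, i < x → σ x = x := by
    intro x hx
    by_contra hne
    exact absurd (hmax hne hx.le) hx.not_ge
  have hlt : σ i < i := by
    refine lt_of_le_of_ne ?_ hi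
    by_contra! h
    exact h.ne' (σ.injective (hfix _ h))
  rw [MonomialOrder.lex_lt_iff]
  refine Finsupp.Lex.lt_iff.2 ⟨var (a i) (Fin.castLE hs i), ?_, ?_⟩
  · refine var_cases fun r c hrc => ?_
    rw [var_lt] at hrc
    refine (permExp_apply hs a σ r c).trans ((permExp_apply hs a 1 r c).trans ?_).symm
    refine Finset.sum_congr rfl fun x _ => if_congr (and_congr_right fun hx => ?_) rfl rfl
    rcases hrc with hr | ⟨hr, hc⟩
    · rw [hfix x (ha.lt_iff_lt.1 (by rwa [hx]))]
      rfl
    · obtain rfl : x = i := ha.injective (hx.trans hr.symm)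
      have h1 : Fin.castLE hs x ≠ c := hc.ne
      have h2 : Fin.castLE hs (σ x) ≠ c := by
        have : Fin.castLE hs (σ x) < Fin.castLE hs x := hlt
        exact (this.trans hc).ne
      simp [h1, h2]
  · refine (permExp_apply hs a σ _ _).trans_lt (lt_of_lt_of_eq ?_ (permExp_apply hs a 1 _ _).symm)
    rw [Finset.sum_eq_zero]
    · exact Finset.sum_pos' (by simp) ⟨i, by simp⟩
    · intro x _
      rw [if_neg]
      rintro ⟨h1, h2⟩
      obtain rfl := ha.injective h1
      exact hi (Fin.castLE_injective hs h2)

lemma colDet_eq {s : ℕ} (hs : s ≤ q) (a : Fin s → Fin p) :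
    colDet k hs a = ∑ σ : Equiv.Perm (Fin s),
      monomial (∑ x, Finsupp.single (var (a x) (Fin.castLE hs (σ x))) 1)
        ((Equiv.Perm.sign σ : ℤ) : k) := by
  rw [colDet, ← Matrix.det_transpose, Matrix.det_apply']
  refine Finset.sum_congr rfl fun σ _ => ?_
  rw [← mul_one ((Equiv.Perm.sign σ : ℤ) : k), ← C_mul_monomial, monomial_sum_one]
  simp [X]

lemma degree_colDet_le {s : ℕ} (hs : s ≤ q) {a : Fin s → Fin p} (ha : StrictMono a) :
    MonomialOrder.lex.degree (colDet k hs a) ≼[MonomialOrder.lex] colExp hs a := by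
  classical
  rw [MonomialOrder.degree_le_iff]
  intro e he
  rw [colDet_eq, mem_support_iff, coeff_sum] at he
  obtain ⟨σ, -, hσ⟩ := Finset.exists_ne_zero_of_sum_ne_zero he
  rw [coeff_monomial] at hσ
  split_ifs at hσ with h
  · rw [← h]
    rcases eq_or_ne σ 1 with rfl | h1
    · exact le_rfl
    · exact (permExp_lt hs ha h1).le
  · exact absurd rfl hσ

lemma coeff_colDet {s : ℕ} (hs : s ≤ q) {a : Fin s → Fin p} (ha : StrictMono a) :
    coeff (colExp hs a) (colDet k hs a) = 1 := by
  classical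
  rw [colDet_eq, coeff_sum, Finset.sum_eq_single 1]
  · rw [coeff_monomial]
    exact (if_pos rfl).trans (by simp)
  · intro σ _ hσ
    rw [coeff_monomial, if_neg]
    intro h
    exact (permExp_lt hs ha hσ).ne (congrArg _ h)
  · simp

end

section

variable {k : Type*} [Field k] {p q : ℕ}

lemma exists_of_mem_support_mul {σ R : Type*} [CommRing R] {F G : MvPolynomial σ R} {m : σ →₀ ℕ}
    (h : coeff m (F * G) ≠ 0) :
    ∃ m₁ m₂, m₁ + m₂ = m ∧ coeff m₁ F ≠ 0 ∧ coeff m₂ G ≠ 0 := by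
  classical
  rw [coeff_mul] at h
  obtain ⟨⟨m₁, m₂⟩, hm, h⟩ := Finset.exists_ne_zero_of_sum_ne_zero h
  exact ⟨m₁, m₂, by simpa using hm, left_ne_zero_of_mul h, right_ne_zero_of_mul h⟩

section Weight

variable {σ R : Type*} [Fintype σ] [CommRing R]

/-- The value of an additive functional on exponents. -/
def wt (w : σ → ℤ) (m : σ →₀ ℕ) : ℤ := ∑ z, (m z : ℤ) * w z

lemma wt_add (w : σ → ℤ) (m m' : σ →₀ ℕ) : wt w (m + m') = wt w m + wt w m' := by
  simp [wt, add_mul, Finset.sum_add_distrib]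

lemma wt_zero (w : σ → ℤ) : wt w 0 = 0 := by
  simp [wt]

lemma wt_add_left (w w' : σ → ℤ) (m : σ →₀ ℕ) : wt (w + w') m = wt w m + wt w' m := by
  simp [wt, mul_add, Finset.sum_add_distrib]

lemma wt_neg_left (w : σ → ℤ) (m : σ →₀ ℕ) : wt (-w) m = -wt w m := by
  simp [wt]

lemma wt_zero_left (m : σ →₀ ℕ) : wt (0 : σ → ℤ) m = 0 := by
  simp [wt]

lemma wt_pi_single [DecidableEq σ] (x : σ) (m : σ →₀ ℕ) : wt (Pi.single x 1) m = m x := by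
  simp [wt, Pi.single_apply]

lemma wt_single (w : σ → ℤ) (x : σ) : wt w (Finsupp.single x 1) = w x := by
  classical
  simp [wt, Finsupp.single_apply]

/-- A bound for a functional on the monomials substituted for the variables gives a bound on the
monomials of a substituted monomial. -/
lemma wt_le_of_coeff_ne_zero {P : σ → MvPolynomial σ R} {w w' : σ → ℤ}
    (hP : ∀ y m, coeff m (P y) ≠ 0 → wt w m ≤ w' y) {e m : σ →₀ ℕ} {c : R}
    (h : coeff m (eval₂Hom C P (monomial e c)) ≠ 0) : wt w m ≤ wt w' e := by
  classical
  have key : ∀ e m, coeff m (eval₂Hom C P (monomial e 1)) ≠ 0 → wt w m ≤ wt w' e := by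
    intro e
    induction e using Finsupp.induction_linear with
    | zero =>
      intro m hm
      rw [← C_apply, map_one, map_one, coeff_one] at hm
      split_ifs at hm with h0
      · rw [← h0, wt_zero, wt_zero]
      · exact absurd rfl hm
    | add e e' he he' =>
      intro m hm
      rw [show (monomial (e + e') (1 : R)) = monomial e 1 * monomial e' 1 by
        rw [monomial_mul, mul_one], map_mul] at hm
      obtain ⟨m₁, m₂, rfl, h1, h2⟩ := exists_of_mem_support_mul hm
      rw [wt_add, wt_add]
      exact add_le_add (he _ h1) (he' _ h2)
    | single y n =>
      induction n with
      | zero =>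
        intro m hm
        rw [Finsupp.single_zero, ← C_apply, map_one, map_one, coeff_one] at hm
        split_ifs at hm with h0
        · rw [← h0, Finsupp.single_zero, wt_zero, wt_zero]
        · exact absurd rfl hm
      | succ n ih =>
        intro m hm
        rw [Finsupp.single_add, show (monomial (Finsupp.single y n + Finsupp.single y 1) (1 : R)) =
          monomial (Finsupp.single y n) 1 * X y by rw [X, monomial_mul, mul_one], map_mul,
          coe_eval₂Hom, eval₂_X] at hm
        obtain ⟨m₁, m₂, rfl, h1, h2⟩ := exists_of_mem_support_mul hm
        rw [Finsupp.single_add, wt_add, wt_add, wt_single]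
        exact add_le_add (ih _ h1) (hP _ _ h2)
  refine key e m fun h0 => h ?_
  rw [← mul_one c, ← C_mul_monomial, map_mul, coe_eval₂Hom, eval₂_C, coeff_C_mul]
  rw [coe_eval₂Hom] at h0
  rw [h0, mul_zero]

/-- The monomial `E` is the unique one of maximal weight in `F`, with coefficient one. -/
def IsTop (w : σ → ℤ) (F : MvPolynomial σ R) (E : σ →₀ ℕ) : Prop :=
  coeff E F = 1 ∧ ∀ m, coeff m F ≠ 0 → m ≠ E → wt w m < wt w E

lemma IsTop.mul {w : σ → ℤ} {F G : MvPolynomial σ R} {E E' : σ →₀ ℕ} (hF : IsTop w F E)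
    (hG : IsTop w G E') : IsTop w (F * G) (E + E') := by
  classical
  have hlt : ∀ m₁ m₂, coeff m₁ F ≠ 0 → coeff m₂ G ≠ 0 → ¬ (m₁ = E ∧ m₂ = E') →
      wt w (m₁ + m₂) < wt w (E + E') := by
    intro m₁ m₂ h1 h2 hne
    rw [wt_add, wt_add]
    by_cases e1 : m₁ = E
    · subst e1
      linarith [hG.2 m₂ h2 fun e2 => hne ⟨rfl, e2⟩]
    · by_cases e2 : m₂ = E'
      · subst e2
        linarith [hF.2 m₁ h1 e1]
      · linarith [hF.2 m₁ h1 e1, hG.2 m₂ h2 e2]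
  constructor
  · rw [coeff_mul, Finset.sum_eq_single (E, E'), hF.1, hG.1, mul_one]
    · rintro ⟨m₁, m₂⟩ hm hne
      by_contra h
      have hm : m₁ + m₂ = E + E' := by simpa using hm
      have := hlt m₁ m₂ (left_ne_zero_of_mul h) (right_ne_zero_of_mul h)
        fun ⟨h1, h2⟩ => hne (by rw [h1, h2])
      rw [hm] at this
      exact this.false
    · intro h
      exact absurd (by simp) h
  · intro m hm hne
    obtain ⟨m₁, m₂, rfl, h1, h2⟩ := exists_of_mem_support_mul hm
    exact hlt m₁ m₂ h1 h2 fun ⟨e1, e2⟩ => hne (by rw [e1, e2])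

lemma isTop_one (w : σ → ℤ) : IsTop w (1 : MvPolynomial σ R) 0 := by
  classical
  refine ⟨coeff_zero_one, fun m hm hne => ?_⟩
  rw [coeff_one, if_neg (Ne.symm hne)] at hm
  exact absurd rfl hm

lemma isTop_eval₂Hom_monomial {P : σ → MvPolynomial σ R} {w : σ → ℤ} {ℓ : σ → σ}
    (hP : ∀ y, IsTop w (P y) (Finsupp.single (ℓ y) 1)) (e : σ →₀ ℕ) :
    IsTop w (eval₂Hom C P (monomial e 1)) (e.mapDomain ℓ) := by
  induction e using Finsupp.induction_linear with
  | zero =>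
    rw [← C_apply, map_one, map_one, Finsupp.mapDomain_zero]
    exact isTop_one w
  | add e e' he he' =>
    rw [show (monomial (e + e') (1 : R)) = monomial e 1 * monomial e' 1 by
      rw [monomial_mul, mul_one], map_mul, Finsupp.mapDomain_add]
    exact he.mul he'
  | single y n =>
    induction n with
    | zero =>
      rw [Finsupp.single_zero, ← C_apply, map_one, map_one, Finsupp.mapDomain_zero]
      exact isTop_one w
    | succ n ih =>
      rw [Finsupp.single_add, show (monomial (Finsupp.single y n + Finsupp.single y 1) (1 : R)) =
        monomial (Finsupp.single y n) 1 * X y by rw [X, monomial_mul, mul_one], map_mul,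
        Finsupp.mapDomain_add, Finsupp.mapDomain_single (a := y) (b := 1), coe_eval₂Hom, eval₂_X]
      exact ih.mul (hP y)

lemma isTop_X (w : σ → ℤ) (x : σ) : IsTop w (X x : MvPolynomial σ R) (Finsupp.single x 1) := by
  classical
  refine ⟨by rw [coeff_X, if_pos rfl], fun m hm hne => ?_⟩
  rw [coeff_X, if_neg (Ne.symm hne)] at hm
  exact absurd rfl hm

end Weight

end

section

variable {k : Type*} [Field k] {p q : ℕ}

lemma exists_coeff_map_monomial_ne_zero {σ R : Type*} [CommRing R]
    (ψ : MvPolynomial σ R →+* MvPolynomial σ R) {G : MvPolynomial σ R} {m : σ →₀ ℕ}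
    (h : coeff m (ψ G) ≠ 0) : ∃ e, coeff e G ≠ 0 ∧ coeff m (ψ (monomial e (coeff e G))) ≠ 0 := by
  rw [G.as_sum, map_sum, coeff_sum] at h
  obtain ⟨e, he, h⟩ := Finset.exists_ne_zero_of_sum_ne_zero h
  exact ⟨e, mem_support_iff.1 he, h⟩

lemma wt_le_of_rel {σ R : Type*} [Fintype σ] [CommRing R] {P : σ → MvPolynomial σ R}
    {Rel : σ → σ → Prop}
    (hP : ∀ y m, coeff m (P y) ≠ 0 → ∃ x, m = Finsupp.single x 1 ∧ Rel y x) {w w' : σ → ℤ}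
    (h : ∀ y x, Rel y x → w x ≤ w' y) {e m : σ →₀ ℕ} {c : R}
    (hm : coeff m (eval₂Hom C P (monomial e c)) ≠ 0) : wt w m ≤ wt w' e := by
  refine wt_le_of_coeff_ne_zero (fun y m hm => ?_) hm
  obtain ⟨x, rfl, hx⟩ := hP y m hm
  rw [wt_single]
  exact h y x hx

section TwoColumns

variable (i : Fin p) (j j' : Fin q)

/-- A substitution in two columns; see `opFst_comp_colAdd`. -/
noncomputable def opFst (x : Var p q) : Coeff k p q :=
  if x.2 = j then if x.1 < i then X x + X (var x.1 j') else X x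
  else if x.2 = j' then
    if x.1 < i then -X (var x.1 j) else if x.1 = i then 0 else X x - X (var x.1 j)
  else X x

/-- A substitution in two columns; see `opFst_comp_colAdd`. -/
noncomputable def opSnd (x : Var p q) : Coeff k p q :=
  if x.2 = j then if x.1 < i then X x + X (var x.1 j') else X x
  else if x.2 = j' then if x.1 = i then X (var x.1 j) else X x
  else X x

variable {i j j'}

lemma opFst_comp_colAdd (hj : j ≠ j') :
    (eval₂Hom C (opFst (k := k) i j j')).comp (colAdd j j') = eval₂Hom C (opSnd i j j') := by
  refine MvPolynomial.ringHom_ext (fun r => by simp [colAdd]) (var_cases fun r c => ?_)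
  simp only [colAdd, RingHom.comp_apply, coe_eval₂Hom, eval₂_X]
  have e1 : (var r c).1 = r := rfl
  have e2 : (var r c).2 = c := rfl
  have e3 : (var r j).1 = r := rfl
  have e4 : (var r j).2 = j := rfl
  by_cases hc : c = j'
  · subst hc
    simp only [e2, if_true, eval₂_add, eval₂_X, opFst, opSnd, e1, e3, e4, hj.symm, if_false]
    rcases lt_trichotomy r i with h | h | h
    · simp [h, h.ne]
    · simp [h]
    · simp [h.not_gt, h.ne']
  · simp [e2, hc, opFst, opSnd]

/-- The pairs of a variable and a variable in its image under `opFst`. -/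
def RelFst (i : Fin p) (j j' : Fin q) (y x : Var p q) : Prop :=
  x.1 = y.1 ∧ (x.2 = y.2 ∧ (y.2 = j' → i < y.1) ∨ y.2 = j ∧ y.1 < i ∧ x.2 = j' ∨
    y.2 = j' ∧ y.1 ≠ i ∧ x.2 = j)

/-- The pairs of a variable and a variable in its image under `opSnd`. -/
def RelSnd (i : Fin p) (j j' : Fin q) (y x : Var p q) : Prop :=
  x.1 = y.1 ∧ (x.2 = y.2 ∧ (y.2 = j' → y.1 ≠ i) ∨ y.2 = j ∧ y.1 < i ∧ x.2 = j' ∨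
    y.2 = j' ∧ y.1 = i ∧ x.2 = j)

lemma eq_single_of_coeff_X {σ R : Type*} [CommRing R] {x : σ} {m : σ →₀ ℕ}
    (h : coeff m (X x : MvPolynomial σ R) ≠ 0) : m = Finsupp.single x 1 := by
  classical
  rw [coeff_X] at h
  by_contra hne
  exact h (if_neg (Ne.symm hne))

lemma coeff_add_ne_zero {σ R : Type*} [CommRing R] {F G : MvPolynomial σ R} {m : σ →₀ ℕ}
    (h : coeff m (F + G) ≠ 0) : coeff m F ≠ 0 ∨ coeff m G ≠ 0 := by
  by_contra! hcon
  rw [coeff_add, hcon.1, hcon.2, add_zero] at h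
  exact h rfl

lemma relFst_of_coeff (hj : j ≠ j') (y : Var p q) (m : Var p q →₀ ℕ)
    (h : coeff m (opFst (k := k) i j j' y) ≠ 0) :
    ∃ x, m = Finsupp.single x 1 ∧ RelFst i j j' y x := by
  induction y using var_cases with | h r c =>
  have e1 : (var r c).1 = r := rfl
  have e2 : (var r c).2 = c := rfl
  simp only [opFst, e1, e2] at h
  split_ifs at h with h1 h2 h2 h3 h4
  · rcases coeff_add_ne_zero h with h | h
    · exact ⟨_, eq_single_of_coeff_X h, rfl, .inl ⟨rfl, fun h => absurd (h1.symm.trans h) hj⟩⟩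
    · exact ⟨_, eq_single_of_coeff_X h, rfl, .inr (.inl ⟨h1, h2, rfl⟩)⟩
  · exact ⟨_, eq_single_of_coeff_X h, rfl, .inl ⟨rfl, fun h => absurd (h1.symm.trans h) hj⟩⟩
  · rw [coeff_neg, neg_ne_zero] at h
    exact ⟨_, eq_single_of_coeff_X h, rfl, .inr (.inr ⟨h2, h3.ne, rfl⟩)⟩
  · simp at h
  · rw [sub_eq_add_neg] at h
    rcases coeff_add_ne_zero h with h | h
    · exact ⟨_, eq_single_of_coeff_X h, rfl,
        .inl ⟨rfl, fun _ => lt_of_le_of_ne (not_lt.1 h3) (Ne.symm h4)⟩⟩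
    · rw [coeff_neg, neg_ne_zero] at h
      exact ⟨_, eq_single_of_coeff_X h, rfl, .inr (.inr ⟨h2, h4, rfl⟩)⟩
  · exact ⟨_, eq_single_of_coeff_X h, rfl, .inl ⟨rfl, fun h => absurd h h2⟩⟩

lemma relSnd_of_coeff (hj : j ≠ j') (y : Var p q) (m : Var p q →₀ ℕ)
    (h : coeff m (opSnd (k := k) i j j' y) ≠ 0) :
    ∃ x, m = Finsupp.single x 1 ∧ RelSnd i j j' y x := by
  induction y using var_cases with | h r c =>
  have e1 : (var r c).1 = r := rfl
  have e2 : (var r c).2 = c := rfl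
  simp only [opSnd, e1, e2] at h
  split_ifs at h with h1 h2 h2 h3
  · rcases coeff_add_ne_zero h with h | h
    · exact ⟨_, eq_single_of_coeff_X h, rfl, .inl ⟨rfl, fun h => absurd (h1.symm.trans h) hj⟩⟩
    · exact ⟨_, eq_single_of_coeff_X h, rfl, .inr (.inl ⟨h1, h2, rfl⟩)⟩
  · exact ⟨_, eq_single_of_coeff_X h, rfl, .inl ⟨rfl, fun h => absurd (h1.symm.trans h) hj⟩⟩
  · exact ⟨_, eq_single_of_coeff_X h, rfl, .inr (.inr ⟨h2, h3, rfl⟩)⟩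
  · exact ⟨_, eq_single_of_coeff_X h, rfl, .inl ⟨rfl, fun _ => h3⟩⟩
  · exact ⟨_, eq_single_of_coeff_X h, rfl, .inl ⟨rfl, fun h => absurd h h2⟩⟩

lemma relFst_var {r r' : Fin p} {c c' : Fin q} : RelFst i j j' (var r c) (var r' c') ↔
    r' = r ∧ (c' = c ∧ (c = j' → i < r) ∨ c = j ∧ r < i ∧ c' = j' ∨ c = j' ∧ r ≠ i ∧ c' = j) :=
  Iff.rfl

lemma relSnd_var {r r' : Fin p} {c c' : Fin q} : RelSnd i j j' (var r c) (var r' c') ↔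
    r' = r ∧ (c' = c ∧ (c = j' → r ≠ i) ∨ c = j ∧ r < i ∧ c' = j' ∨ c = j' ∧ r = i ∧ c' = j) :=
  Iff.rfl

lemma opFst_exponents (hj : j ≠ j') {e m : Var p q →₀ ℕ} {a : k}
    (h : coeff m (eval₂Hom C (opFst i j j') (monomial e a)) ≠ 0) :
    (∀ r c, c ≠ j → c ≠ j' → m (var r c) = e (var r c)) ∧
    (∀ r, m (var r j) + m (var r j') = e (var r j) + e (var r j')) ∧
    (∀ r, i < r → m (var r j') ≤ e (var r j')) ∧ (∀ r < i, e (var r j') ≤ m (var r j)) ∧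
    e (var i j') = 0 := by
  have key : ∀ w w' : Var p q → ℤ, (∀ r c r' c', RelFst i j j' (var r c) (var r' c') →
      w (var r' c') ≤ w' (var r c)) → wt w m ≤ wt w' e := fun w w' hw =>
    wt_le_of_rel (relFst_of_coeff hj) (fun y x => hw y.1 y.2 x.1 x.2) h
  simp only [relFst_var] at key
  refine ⟨fun r c hc hc' => le_antisymm ?_ ?_, fun r => le_antisymm ?_ ?_, fun r hr => ?_,
    fun r hr => ?_, ?_⟩
  · have := key (Pi.single (var r c) 1) (Pi.single (var r c) 1)
      (by simp only [Pi.single_apply, var_inj]; grind)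
    simpa [wt_pi_single] using this
  · have := key (-Pi.single (var r c) 1) (-Pi.single (var r c) 1)
      (by simp only [Pi.neg_apply, Pi.single_apply, var_inj]; grind)
    simpa [wt_pi_single, wt_neg_left] using this
  · have := key (Pi.single (var r j) 1 + Pi.single (var r j') 1)
      (Pi.single (var r j) 1 + Pi.single (var r j') 1)
      (by simp only [Pi.add_apply, Pi.single_apply, var_inj]; grind)
    simp only [wt_pi_single, wt_add_left] at this
    exact_mod_cast this
  · have := key (-(Pi.single (var r j) 1 + Pi.single (var r j') 1))
      (-(Pi.single (var r j) 1 + Pi.single (var r j') 1))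
      (by simp only [Pi.neg_apply, Pi.add_apply, Pi.single_apply, var_inj]; grind)
    simp only [wt_pi_single, wt_add_left, wt_neg_left] at this
    omega
  · have := key (Pi.single (var r j') 1) (Pi.single (var r j') 1)
      (by simp only [Pi.single_apply, var_inj]; grind)
    simpa [wt_pi_single] using this
  · have := key (-Pi.single (var r j) 1) (-Pi.single (var r j') 1)
      (by simp only [Pi.neg_apply, Pi.single_apply, var_inj]; grind)
    simpa [wt_pi_single, wt_neg_left] using this
  · have := key 0 (-Pi.single (var i j') 1)
      (by simp only [Pi.neg_apply, Pi.zero_apply, Pi.single_apply, var_inj]; grind)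
    simp only [wt_pi_single, wt_zero_left, wt_neg_left] at this
    omega

lemma opSnd_exponents (hj : j ≠ j') {e m : Var p q →₀ ℕ} {a : k}
    (h : coeff m (eval₂Hom C (opSnd i j j') (monomial e a)) ≠ 0) :
    (∀ r c, c ≠ j → c ≠ j' → m (var r c) = e (var r c)) ∧
    (∀ r, m (var r j) + m (var r j') = e (var r j) + e (var r j')) ∧
    (∀ r, i < r → m (var r j') = e (var r j')) ∧ (∀ r < i, m (var r j) ≤ e (var r j)) := by
  have key : ∀ w w' : Var p q → ℤ, (∀ r c r' c', RelSnd i j j' (var r c) (var r' c') →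
      w (var r' c') ≤ w' (var r c)) → wt w m ≤ wt w' e := fun w w' hw =>
    wt_le_of_rel (relSnd_of_coeff hj) (fun y x => hw y.1 y.2 x.1 x.2) h
  simp only [relSnd_var] at key
  refine ⟨fun r c hc hc' => le_antisymm ?_ ?_, fun r => le_antisymm ?_ ?_,
    fun r hr => le_antisymm ?_ ?_, fun r hr => ?_⟩
  · have := key (Pi.single (var r c) 1) (Pi.single (var r c) 1)
      (by simp only [Pi.single_apply, var_inj]; grind)
    simpa [wt_pi_single] using this
  · have := key (-Pi.single (var r c) 1) (-Pi.single (var r c) 1)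
      (by simp only [Pi.neg_apply, Pi.single_apply, var_inj]; grind)
    simpa [wt_pi_single, wt_neg_left] using this
  · have := key (Pi.single (var r j) 1 + Pi.single (var r j') 1)
      (Pi.single (var r j) 1 + Pi.single (var r j') 1)
      (by simp only [Pi.add_apply, Pi.single_apply, var_inj]; grind)
    simp only [wt_pi_single, wt_add_left] at this
    exact_mod_cast this
  · have := key (-(Pi.single (var r j) 1 + Pi.single (var r j') 1))
      (-(Pi.single (var r j) 1 + Pi.single (var r j') 1))
      (by simp only [Pi.neg_apply, Pi.add_apply, Pi.single_apply, var_inj]; grind)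
    simp only [wt_pi_single, wt_add_left, wt_neg_left] at this
    omega
  · have := key (Pi.single (var r j') 1) (Pi.single (var r j') 1)
      (by simp only [Pi.single_apply, var_inj]; grind)
    simpa [wt_pi_single] using this
  · have := key (-Pi.single (var r j') 1) (-Pi.single (var r j') 1)
      (by simp only [Pi.neg_apply, Pi.single_apply, var_inj]; grind)
    simpa [wt_pi_single, wt_neg_left] using this
  · have := key (Pi.single (var r j) 1) (Pi.single (var r j) 1)
      (by simp only [Pi.single_apply, var_inj]; grind)
    simpa [wt_pi_single] using this

lemma coeff_opSnd_monomial (hj : j ≠ j') (e : Var p q →₀ ℕ) (a : k) :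
    coeff (e.mapDomain (merge (var i j) (var i j')))
      (eval₂Hom C (opSnd i j j') (monomial e a)) = a := by
  have h := isTop_eval₂Hom_monomial (P := opSnd (k := k) i j j')
    (w := fun x => if x.2 = j ∧ x.1 < i then 1 else 0) (ℓ := merge (var i j) (var i j'))
    (fun y => ?_) e
  · rw [← mul_one a, ← C_mul_monomial, map_mul, coe_eval₂Hom, eval₂_C, coeff_C_mul]
    exact congrArg (a * ·) h.1
  · induction y using var_cases with | h r c =>
    have e1 : (var r c).1 = r := rfl
    have e2 : (var r c).2 = c := rfl
    simp only [opSnd, e1, e2, merge, var_inj]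
    by_cases hc : c = j
    · subst hc
      rw [if_pos rfl, if_neg (c := r = i ∧ c = j') fun h => hj h.2]
      split_ifs with hr
      · refine ⟨?_, fun m hm hne => ?_⟩
        · rw [coeff_add, coeff_X, coeff_X, if_pos rfl, if_neg, add_zero]
          rw [Finsupp.single_left_inj one_ne_zero, var_inj]
          exact fun h => hj h.2.symm
        · rcases coeff_add_ne_zero hm with h | h
          · exact absurd (eq_single_of_coeff_X h) hne
          · rw [eq_single_of_coeff_X h, wt_single, wt_single]
            have e3 : (var r j').1 = r := rfl
            have e4 : (var r j').2 = j' := rfl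
            simp [e1, e2, e3, e4, hr, hj.symm]
      · exact isTop_X _ _
    · rw [if_neg hc]
      by_cases hc' : c = j'
      · by_cases hr : r = i
        · rw [if_pos hc', if_pos hr, if_pos ⟨hr, hc'⟩, hr]
          exact isTop_X _ _
        · rw [if_pos hc', if_neg hr, if_neg (by tauto)]
          exact isTop_X _ _
      · rw [if_neg hc', if_neg (by tauto)]
        exact isTop_X _ _

/-- If a polynomial with homogeneous columns is invariant under adding column `j` to column `j'`,
its leading exponent satisfies the semistandardness inequalities in these columns. -/
lemma sum_le_sum_of_colAdd_eq (hj : j < j') {G : Coeff k p q} (hG : colAdd j j' G = G)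
    (hcol : ∀ e e', coeff e G ≠ 0 → coeff e' G ≠ 0 → ∀ c, colSum e c = colSum e' c)
    {e : Var p q →₀ ℕ} (he : coeff e G ≠ 0)
    (hmax : ∀ e', coeff e' G ≠ 0 → e' ≼[MonomialOrder.lex] e) (i : Fin p) :
    ∑ r with r ≤ i, e (var r j') ≤ ∑ r with r < i, e (var r j) := by
  have hne : j ≠ j' := hj.ne
  have hvne : var i j ≠ var i j' := fun h => hne (var_inj.1 h).2
  set E := e.mapDomain (merge (var i j) (var i j')) with hE
  have hE1 : E (var i j) = e (var i j) + e (var i j') := mapDomain_merge_apply hvne e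
  have hE3 : ∀ r c, ¬ (r = i ∧ c = j) → ¬ (r = i ∧ c = j') → E (var r c) = e (var r c) :=
    fun r c h h' => mapDomain_merge_apply_of_ne (fun h0 => h (var_inj.1 h0))
      (fun h0 => h' (var_inj.1 h0)) e
  have hE2 : E (var i j') = 0 := by
    have := (opSnd_exponents (i := i) hne (e := e) (m := E) (a := (1 : k)) (by
      rw [hE, coeff_opSnd_monomial hne]; exact one_ne_zero)).2.1 i
    omega
  have hSnd : ∀ e', coeff e' G ≠ 0 →
      coeff E (eval₂Hom C (opSnd i j j') (monomial e' (coeff e' G))) ≠ 0 → e' = e := by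
    intro e' he' h
    obtain ⟨h1, h2, h3, h4⟩ := opSnd_exponents hne h
    have hoff : ∀ r c, c ≠ j → c ≠ j' → e' (var r c) = e (var r c) := fun r c hc hc' => by
      rw [← h1 r c hc hc', hE3 r c (fun h => hc h.2) fun h => hc' h.2]
    have hrow : ∀ r, e' (var r j) + e' (var r j') = e (var r j) + e (var r j') := by
      intro r
      rw [← h2 r]
      by_cases hr : r = i
      · rw [hr, hE1, hE2, add_zero]
      · rw [hE3 r j (by tauto) (by tauto), hE3 r j' (by tauto) (by tauto)]
    have hgt : ∀ r, i < r → e' (var r j') = e (var r j') := fun r hr => by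
      rw [← h3 r hr, hE3 r j' (fun h => hr.ne' h.1) fun h => hr.ne' h.1]
    have hi : e' (var i j') ≤ e (var i j') := by
      refine lex_le_apply (hmax e' he') _ (var_cases fun r c hx => ?_)
      rw [var_lt] at hx
      by_cases hc : c = j
      · subst hc
        rcases hx with hx | hx
        · have := hrow r
          have := hgt r hx
          omega
        · exact absurd hx.2 hj.not_gt
      · by_cases hc' : c = j'
        · subst hc'
          exact hgt r (hx.resolve_right fun h => h.2.false)
        · exact hoff r c hc hc'
    have hle : ∀ r, e (var r j) ≤ e' (var r j) := by
      intro r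
      have h0 := hrow r
      rcases lt_trichotomy r i with hr | rfl | hr
      · have := h4 r hr
        rwa [hE3 r j (fun h => hr.ne h.1) fun h => hr.ne h.1] at this
      · omega
      · have := hgt r hr
        omega
    have heq : ∀ r, e (var r j) = e' (var r j) := fun r =>
      (Finset.sum_eq_sum_iff_of_le fun r _ => hle r).1 (hcol e e' he he' j) r (mem_univ r)
    refine Finsupp.ext (var_cases fun r c => ?_)
    by_cases hc : c = j
    · rw [hc, heq]
    · by_cases hc' : c = j'
      · have := hrow r
        have := heq r
        rw [hc']
        omega
      · exact hoff r c hc hc'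
  have hcoeff : coeff E (eval₂Hom C (opSnd i j j') G) = coeff e G := by
    conv_lhs => rw [G.as_sum]
    rw [map_sum, coeff_sum, Finset.sum_eq_single e, hE, coeff_opSnd_monomial hne]
    · intro e' he' hne'
      by_contra h
      exact hne' (hSnd e' (mem_support_iff.1 he') h)
    · intro h
      exact absurd (mem_support_iff.2 he) h
  rw [← opFst_comp_colAdd hne, RingHom.comp_apply, hG] at hcoeff
  obtain ⟨e', he', h⟩ := exists_coeff_map_monomial_ne_zero _ (hcoeff ▸ he)
  obtain ⟨h1, h2, h3, h4, h5⟩ := opFst_exponents hne h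
  have hoff : ∀ r c, c ≠ j → c ≠ j' → e' (var r c) = e (var r c) := fun r c hc hc' => by
    rw [← h1 r c hc hc', hE3 r c (fun h => hc h.2) fun h => hc' h.2]
  have hrow : ∀ r, r ≠ i → e' (var r j) + e' (var r j') = e (var r j) + e (var r j') := by
    intro r hr
    rw [← h2 r, hE3 r j (by tauto) (by tauto), hE3 r j' (by tauto) (by tauto)]
  have hgt : ∀ r, i < r → e' (var r j') = e (var r j') := by
    intro r
    induction r using WellFoundedGT.induction with
    | ind r ih =>
    intro hr
    refine le_antisymm ?_ ?_
    · refine lex_le_apply (hmax e' he') _ (var_cases fun r' c hx => ?_)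
      rw [var_lt] at hx
      by_cases hc : c = j
      · subst hc
        rcases hx with hx | hx
        · have := hrow r' (hr.trans hx).ne'
          have := ih r' hx (hr.trans hx)
          omega
        · exact absurd hx.2 hj.not_gt
      · by_cases hc' : c = j'
        · subst hc'
          have hx := hx.resolve_right fun h => h.2.false
          exact ih r' hx (hr.trans hx)
        · exact hoff r' c hc hc'
    · have := h3 r hr
      rwa [hE3 r j' (fun h => hr.ne' h.1) fun h => hr.ne' h.1] at this
  have hsplit : ∀ f : Fin p → ℕ, ∑ r, f r = ∑ r with r ≤ i, f r + ∑ r with i < r, f r := by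
    intro f
    rw [← Finset.sum_filter_add_sum_filter_not univ (· ≤ i)]
    simp only [not_le]
  have hsum := hcol e e' he he' j'
  rw [colSum, colSum, hsplit, hsplit, Finset.sum_congr rfl fun r hr =>
    hgt r (Finset.mem_filter.1 hr).2, Nat.add_right_cancel_iff] at hsum
  have hlt : ∑ r with r ≤ i, e' (var r j') = ∑ r with r < i, e' (var r j') := by
    symm
    refine Finset.sum_subset (fun r hr => ?_) fun r hr hr' => ?_
    · simpa using (Finset.mem_filter.1 hr).2.le
    · have : r = i := by
        simp only [Finset.mem_filter, Finset.mem_univ, true_and] at hr hr'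
        exact le_antisymm hr (not_lt.1 hr')
      rw [this, h5]
  rw [hsum, hlt]
  refine Finset.sum_le_sum fun r hr => ?_
  have hr : r < i := by simpa using hr
  have := h4 r hr
  rwa [hE3 r j (fun h => hr.ne h.1) fun h => hr.ne h.1] at this

end TwoColumns

end

section

variable {k : Type*} [Field k] {p q : ℕ}

/-- The semistandardness inequalities between the columns of an exponent. -/
def IsGood (e : Var p q →₀ ℕ) : Prop :=
  ∀ j j', j < j' → ∀ i, ∑ r with r ≤ i, e (var r j') ≤ ∑ r with r < i, e (var r j)

lemma colExp_apply {s : ℕ} (hs : s ≤ q) (a : Fin s → Fin p) (r : Fin p) (c : Fin q) :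
    colExp hs a (var r c) = if h : (c : ℕ) < s then if a ⟨c, h⟩ = r then 1 else 0 else 0 := by
  rw [colExp]
  simp only [Finsupp.finsetSum_apply, Finsupp.single_apply, var_inj]
  split_ifs with h h'
  · rw [Finset.sum_eq_single ⟨c, h⟩]
    · exact if_pos ⟨h', rfl⟩
    · rintro x - hx
      refine if_neg ?_
      rintro ⟨-, rfl⟩
      exact hx rfl
    · exact fun h0 => absurd (mem_univ _) h0
  · refine Finset.sum_eq_zero fun x _ => if_neg ?_
    rintro ⟨h1, rfl⟩
    exact h' h1
  · refine Finset.sum_eq_zero fun x _ => if_neg ?_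
    rintro ⟨-, rfl⟩
    exact h x.2

/-- The first nonzero entries of the nonzero columns of a good exponent can be split off. -/
lemma IsGood.exists_eq_add_colExp {e : Var p q →₀ ℕ} (he : IsGood e) {s : ℕ} (hs : s ≤ q)
    (hcol : ∀ c, colSum e c ≠ 0 ↔ (c : ℕ) < s) :
    ∃ a : Fin s → Fin p, StrictMono a ∧ ∃ e', e = e' + colExp hs a ∧ IsGood e' ∧
      ∀ c, colSum e c = colSum e' c + initExp q s c := by
  classical
  have hex : ∀ x : Fin s, ∃ r, e (var r (Fin.castLE hs x)) ≠ 0 ∧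
      ∀ r' < r, e (var r' (Fin.castLE hs x)) = 0 := by
    intro x
    obtain ⟨r, -, hr⟩ := Finset.exists_ne_zero_of_sum_ne_zero ((hcol (Fin.castLE hs x)).2 x.2)
    obtain ⟨r, hr, hmin⟩ := WellFounded.has_min (wellFounded_lt (α := Fin p))
      {r | e (var r (Fin.castLE hs x)) ≠ 0} ⟨r, hr⟩
    exact ⟨r, hr, fun r' h => by_contra fun h' => hmin r' h' h⟩
  choose a ha hmin using hex
  have hmono : StrictMono a := by
    intro x y hxy
    have h1 := he (Fin.castLE hs x) (Fin.castLE hs y) hxy (a y)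
    have h2 : 0 < ∑ r with r ≤ a y, e (var r (Fin.castLE hs y)) :=
      Finset.sum_pos' (fun _ _ => Nat.zero_le _) ⟨a y, by simp, Nat.pos_of_ne_zero (ha y)⟩
    obtain ⟨r, hr, hr'⟩ := Finset.exists_ne_zero_of_sum_ne_zero (h2.trans_le h1).ne'
    have hr : r < a y := by simpa using hr
    refine lt_of_le_of_lt ?_ hr
    by_contra! hcon
    exact hr' (hmin x r hcon)
  have hle : colExp hs a ≤ e := by
    refine Finsupp.le_def.2 (var_cases fun r c => ?_)
    rw [colExp_apply]
    split_ifs with h h'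
    · have := ha ⟨c, h⟩
      rw [h'] at this
      exact Nat.one_le_iff_ne_zero.2 this
    · exact Nat.zero_le _
    · exact Nat.zero_le _
  have hadd : e = (e - colExp hs a) + colExp hs a := (tsub_add_cancel_of_le hle).symm
  have hsum : ∀ (t : Finset (Fin p)), IsLowerSet (t : Set (Fin p)) → ∀ c,
      ∑ r ∈ t, (e - colExp hs a) (var r c) = ∑ r ∈ t, e (var r c) - 1 := by
    intro t ht c
    have h1 : ∑ r ∈ t, e (var r c) =
        ∑ r ∈ t, (e - colExp hs a) (var r c) + ∑ r ∈ t, colExp hs a (var r c) := by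
      conv_lhs => rw [hadd]
      rw [← Finset.sum_add_distrib]
      rfl
    simp only [colExp_apply] at h1
    by_cases hc : (c : ℕ) < s
    · simp only [hc, dif_pos, Finset.sum_ite_eq] at h1
      split_ifs at h1 with hmem
      · omega
      · have : ∑ r ∈ t, e (var r c) = 0 := Finset.sum_eq_zero fun r hr =>
          hmin ⟨c, hc⟩ r (not_le.1 fun h => hmem (ht h hr))
        omega
    · have : ∑ r ∈ t, e (var r c) = 0 := by
        refine Nat.eq_zero_of_le_zero
          ((Finset.sum_le_sum_of_subset (Finset.subset_univ t)).trans (le_of_eq ?_))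
        exact not_not.1 fun h => hc ((hcol c).1 h)
      omega
  refine ⟨a, hmono, e - colExp hs a, hadd, fun j j' hj i => ?_, fun c => ?_⟩
  · rw [hsum _ fun x y h hx => by
      simp only [coe_filter, mem_univ, true_and, Set.mem_ofPred_eq] at hx ⊢; exact h.trans hx,
      hsum _ fun x y h hx => by
      simp only [coe_filter, mem_univ, true_and, Set.mem_ofPred_eq] at hx ⊢; exact h.trans_lt hx]
    exact Nat.sub_le_sub_right (he j j' hj i) 1
  · rw [colSum, colSum, hsum univ (fun _ _ _ _ => by simp) c, initExp_apply]
    have := hcol c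
    rw [colSum] at this
    split_ifs with h <;> omega

lemma tail_initExp_le (τ s : ℕ) (hs : s ≤ q) : tail τ (initExp q s) ≤ s - τ := by
  rw [tail, sum_castLE hs _ fun c hc => by simp [initExp_apply, hc]]
  have h1 : ∀ c : Fin s, (if ((Fin.castLE hs c : Fin q) : ℕ) < τ then 0
      else initExp q s (Fin.castLE hs c)) = if (c : ℕ) < τ then 0 else 1 := by
    intro c
    simp [initExp_apply]
  rw [Finset.sum_congr rfl fun c _ => h1 c,
    Fin.sum_univ_eq_sum_range (fun c => if c < τ then 0 else 1) s]
  clear h1 hs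
  induction s with
  | zero => simp
  | succ s ih =>
    rw [Finset.sum_range_succ]
    split_ifs <;> omega

/-- Every good exponent with even column sums is the leading exponent of the leading coefficient
of a linear combination of products of minors. -/
lemma exists_leading (τ : ℕ) {e : Var p q →₀ ℕ} (he : IsGood e) {α : Fin q →₀ ℕ}
    (hα : ∀ c, colSum e c = 2 * α c) :
    ∃ g ∈ weightIdeal k p τ (tail τ α),
      MonomialOrder.lex.degree (gram k p q g) ≼[MonomialOrder.lex] α ∧
      MonomialOrder.lex.degree (coeff α (gram k p q g)) ≼[MonomialOrder.lex] e ∧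
      coeff e (coeff α (gram k p q g)) = 1 := by
  classical
  induction hn : α.degree using Nat.strong_induction_on generalizing α e with
  | _ n ih =>
  subst hn
  by_cases h0 : α = 0
  · subst h0
    have he0 : e = 0 := by
      refine Finsupp.ext (var_cases fun r c => ?_)
      have := hα c
      rw [Finsupp.zero_apply, mul_zero, colSum, Finset.sum_eq_zero_iff] at this
      exact this r (mem_univ r)
    subst he0
    refine ⟨1, by simp [tail, weightIdeal_zero], by simp, ?_, ?_⟩
    · rw [map_one, coeff_zero_one, MonomialOrder.degree_one]
    · rw [map_one, coeff_zero_one, coeff_zero_one]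
  have hanti : ∀ j j', j < j' → colSum e j' ≤ colSum e j := by
    intro j j' hj
    rcases isEmpty_or_nonempty (Fin p) with hp | hp
    · simp [colSum]
    · obtain ⟨i, hi⟩ := Finite.exists_max fun r : Fin p => r
      refine le_trans (le_of_eq ?_) ((he j j' hj i).trans
        (Finset.sum_le_sum_of_subset (Finset.subset_univ _)))
      rw [colSum, Finset.filter_true_of_mem fun r _ => hi r]
  obtain ⟨s, hs, hcol⟩ : ∃ s ≤ q, ∀ c : Fin q, α c ≠ 0 ↔ (c : ℕ) < s := by
    refine ⟨#{c | α c ≠ 0}, (Finset.card_le_univ _).trans (by simp), fun c => ⟨fun h => ?_,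
      fun h => ?_⟩⟩
    · have : Finset.Iic c ⊆ univ.filter fun c => α c ≠ 0 := by
        intro x hx
        rcases (Finset.mem_Iic.1 hx).eq_or_lt with rfl | hx
        · simpa using h
        · have := hanti x c hx
          rw [hα, hα] at this
          simp only [mem_filter, mem_univ, true_and]
          omega
      have := Finset.card_le_card this
      rw [Fin.card_Iic] at this
      omega
    · intro hc
      have : (univ.filter fun c => α c ≠ 0) ⊆ Finset.Iio c := by
        intro x hx
        rw [Finset.mem_Iio]
        by_contra! hcx
        have hx : α x ≠ 0 := by simpa using hx
        rcases hcx.eq_or_lt with rfl | hcx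
        · exact hx hc
        · have := hanti c x hcx
          rw [hα, hα] at this
          omega
      have := Finset.card_le_card this
      rw [Fin.card_Iio] at this
      omega
  obtain ⟨a, ha, e₁, rfl, he₁, hsum₁⟩ := he.exists_eq_add_colExp hs fun c => by
    rw [hα, ← hcol c]; omega
  have hsum₁' : ∀ c, 2 * α c = colSum e₁ c + initExp q s c := fun c => by
    rw [← hα, hsum₁]
  obtain ⟨b, hb, e₂, rfl, he₂, hsum₂⟩ := he₁.exists_eq_add_colExp hs fun c => by
    have := hsum₁' c
    rw [initExp_apply] at this
    have := hcol c
    split_ifs at * <;> omega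
  have hle : initExp q s ≤ α := by
    intro c
    have := hcol c
    rw [initExp_apply]
    split_ifs <;> omega
  obtain ⟨α', rfl⟩ := exists_add_of_le hle
  have hs0 : s ≠ 0 := by
    rintro rfl
    refine h0 (Finsupp.ext fun c => ?_)
    have := hcol c
    simpa using this
  have hα' : ∀ c, colSum e₂ c = 2 * α' c := by
    intro c
    have h1 := hsum₁' c
    have h2 := hsum₂ c
    rw [Finsupp.add_apply] at h1
    omega
  have hdeg : (initExp q s).degree = s := by
    rw [Finsupp.degree_eq_sum, sum_initExp hs]
  obtain ⟨g, hg, hg1, hg2, hg3⟩ := ih α'.degree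
    (by rw [map_add, hdeg]; omega) he₂ hα' rfl
  have hm1 := degree_gram_minor (k := k) hs a b
  have hab : MonomialOrder.lex.degree (colDet k hs b * colDet k hs a) ≼[MonomialOrder.lex]
      colExp hs b + colExp hs a := by
    refine MonomialOrder.degree_mul_le.trans ?_
    rw [map_add, map_add]
    exact add_le_add (degree_colDet_le hs hb) (degree_colDet_le hs ha)
  have hcoeff : coeff (initExp q s + α') (gram k p q (g * minor k a b)) =
      coeff α' (gram k p q g) * (colDet k hs b * colDet k hs a) := by
    rw [map_mul, add_comm, MonomialOrder.coeff_mul_of_add_of_degree_le hg1 hm1,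
      coeff_gram_minor hs, mul_comm (colDet k hs a)]
  refine ⟨g * minor k a b, ?_, ?_, ?_, ?_⟩
  · refine weightIdeal_antitone ?_ (weightIdeal_mul_le _ (s - τ) (Ideal.mul_mem_mul hg
      ((minorProd_minor ha.injective hb.injective).mem_weightIdeal le_rfl)))
    rw [tail_add]
    have := tail_initExp_le τ s hs
    omega
  · rw [map_mul]
    refine MonomialOrder.degree_mul_le.trans ?_
    rw [add_comm (initExp q s), map_add, map_add]
    exact add_le_add hg1 hm1
  · rw [hcoeff, add_assoc]
    refine MonomialOrder.degree_mul_le.trans ?_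
    rw [map_add, map_add]
    exact add_le_add hg2 hab
  · rw [hcoeff, add_assoc, MonomialOrder.coeff_mul_of_add_of_degree_le hg2 hab, hg3, one_mul,
      MonomialOrder.coeff_mul_of_add_of_degree_le (degree_colDet_le hs hb) (degree_colDet_le hs ha),
      coeff_colDet hs hb, coeff_colDet hs ha, one_mul]

lemma eq_or_degree_sub_lt {σ R : Type*} [CommRing R] {m : MonomialOrder σ} {F G : MvPolynomial σ R}
    {E : σ →₀ ℕ} (hF : m.degree F ≼[m] E) (hG : m.degree G ≼[m] E)
    (h : coeff E F = coeff E G) : F = G ∨ m.degree (F - G) ≺[m] E := by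
  refine or_iff_not_imp_left.2 fun hne => lt_of_le_of_ne
    (MonomialOrder.degree_sub_le.trans (max_le hF hG)) fun heq => ?_
  have h1 := m.coeff_degree_ne_zero_iff.2 (sub_ne_zero.2 hne)
  rw [m.toSyn.injective heq, coeff_sub, h, sub_self] at h1
  exact h1 rfl

/-- Leading coefficients are attained by combinations of products of minors. -/
lemma exists_coeff_eq (τ : ℕ) {α : Fin q →₀ ℕ} {f : MvPolynomial (Idx p) k}
    (hf : MonomialOrder.lex.degree (gram k p q f) ≼[MonomialOrder.lex] α) :
    ∃ g ∈ weightIdeal k p τ (tail τ α),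
      MonomialOrder.lex.degree (gram k p q g) ≼[MonomialOrder.lex] α ∧
      coeff α (gram k p q g) = coeff α (gram k p q f) := by
  induction hx : MonomialOrder.lex.toSyn (MonomialOrder.lex.degree (coeff α (gram k p q f))) using
    WellFoundedLT.induction generalizing f with
  | ind x ih =>
  subst hx
  set G := coeff α (gram k p q f) with hG
  by_cases h0 : G = 0
  · refine ⟨0, zero_mem _, ?_, by rw [map_zero, coeff_zero, h0]⟩
    rw [map_zero, MonomialOrder.degree_zero, map_zero]
    exact bot_le
  set e := MonomialOrder.lex.degree G with he
  have he0 : coeff e G ≠ 0 := MonomialOrder.lex.coeff_degree_ne_zero_iff.2 h0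
  have hcol := gram_colHom (q := q) f α
  obtain ⟨g₀, hg₀, h1, h2, h3⟩ := exists_leading (k := k) τ (e := e) (α := α)
    (fun j j' hj => sum_le_sum_of_colAdd_eq hj (colAdd_coeff_gram hj hf)
      (fun e e' h h' c => by rw [hcol e h, hcol e' h']) he0
      fun e' h' => MonomialOrder.lex.le_degree (mem_support_iff.2 h'))
    (hcol e he0)
  set a := coeff e G
  have hC : gram k p q (C a * g₀) = C (C a) * gram k p q g₀ := by
    rw [map_mul]
    congr 1
    simp [gram]
  have hdeg : MonomialOrder.lex.degree (gram k p q (C a * g₀)) ≼[MonomialOrder.lex] α := by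
    rw [hC]
    refine MonomialOrder.degree_mul_le.trans ?_
    rw [MonomialOrder.degree_C, zero_add]
    exact h1
  have hmem : C a * g₀ ∈ weightIdeal k p τ (tail τ α) := Ideal.mul_mem_left _ _ hg₀
  have hcoeff : coeff α (gram k p q (C a * g₀)) = C a * coeff α (gram k p q g₀) := by
    rw [hC, coeff_C_mul]
  have hdeg' : MonomialOrder.lex.degree (C a * coeff α (gram k p q g₀)) ≼[MonomialOrder.lex] e := by
    refine MonomialOrder.degree_mul_le.trans ?_
    rw [MonomialOrder.degree_C, zero_add]
    exact h2
  rcases eq_or_degree_sub_lt (m := MonomialOrder.lex) (le_refl _) hdeg'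
    (show coeff e G = _ by rw [coeff_C_mul, h3, mul_one]) with heq | hlt
  · exact ⟨_, hmem, hdeg, by rw [hcoeff, heq]⟩
  · obtain ⟨g, hg, hg1, hg2⟩ := ih _ hlt (f := f - C a * g₀)
      (by rw [map_sub]; exact MonomialOrder.degree_sub_le.trans (max_le hf hdeg))
      (by rw [map_sub, coeff_sub, hcoeff])
    refine ⟨g + C a * g₀, add_mem hg hmem, ?_, ?_⟩
    · rw [map_add]
      exact MonomialOrder.degree_add_le.trans (max_le hg1 hdeg)
    · rw [map_add, coeff_add, hg2, map_sub, coeff_sub, sub_add_cancel]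

/-- The valuation defined by scaling all but `τ` of the diagonal entries computes the weight. -/
lemma mem_weightIdeal_of_dvd (ε : Fin q ≃ Idx p) {τ N : ℕ} {f : MvPolynomial (Idx p) k}
    (h : scaleVar k p q ^ N ∣ gramScaled k p q τ f) : f ∈ weightIdeal k p τ N := by
  induction hx : MonomialOrder.lex.toSyn (MonomialOrder.lex.degree (gram k p q f)) using
    WellFoundedLT.induction generalizing f with
  | ind x ih =>
  subst hx
  by_cases h0 : f = 0
  · rw [h0]
    exact zero_mem _
  have hne : gram k p q f ≠ 0 := (map_ne_zero_iff _ (gram_injective ε)).2 h0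
  obtain ⟨g, hg, hg1, hg2⟩ := exists_coeff_eq τ (f := f) le_rfl
  have hgN := weightIdeal_antitone
    (le_tail_of_dvd h (MonomialOrder.lex.coeff_degree_ne_zero_iff.2 hne)) hg
  rcases eq_or_degree_sub_lt le_rfl hg1 hg2.symm with heq | hlt
  · rwa [gram_injective ε heq]
  · rw [← map_sub] at hlt
    have := ih _ hlt (f := f - g) (by
      rw [map_sub]
      exact dvd_sub (α := MvPolynomial (Fin q) (Polynomial (Coeff k p q))) h
        (scaleVar_dvd_of_mem hgN)) rfl
    simpa using add_mem this hgN

end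

end GenSym

/-- **Remark `rmk.gensym` (Harbourne–Huneke containment for generic symmetric determinantal
ideals).** Let `I = I_t(Y)` be the ideal of `t`-minors of a generic symmetric `p×p` matrix
of indeterminates, of height `h = (p−t+1)(p−t+2)/2`.  Then for all `m, r ≥ 1`,
`I^{(r(h+m−1))} ⊆ 𝔪^{r(h−1)} (I^{(m)})^r`. -/
theorem stmt_16 {k : Type*} [Field k] (p t : ℕ) (ht : 1 ≤ t) (htp : t ≤ p)
    (h : ℕ) (hh : h = (p - t + 1) * (p - t + 2) / 2) :
    ∀ m r : ℕ, 1 ≤ m → 1 ≤ r →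
      symbolicPower (Ideal.span (genericSymMinors k p t)) (r * (h + m - 1)) ≤
        (Ideal.span (Set.range (MvPolynomial.X : {ij : Fin p × Fin p // ij.1 ≤ ij.2} →
            MvPolynomial {ij : Fin p × Fin p // ij.1 ≤ ij.2} k))) ^ (r * (h - 1)) *
          (symbolicPower (Ideal.span (genericSymMinors k p t)) m) ^ r := by
  intro m r hm _
  obtain ⟨τ, rfl⟩ : ∃ τ, t = τ + 1 := ⟨t - 1, by omega⟩
  have hval := GenSym.containment_of_valuation
    (S := MvPolynomial (Fin (Fintype.card (GenSym.Idx p)))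
      (Polynomial (GenSym.Coeff k p (Fintype.card (GenSym.Idx p)))))
    (GenSym.gramScaled k p (Fintype.card (GenSym.Idx p)) τ) GenSym.scaleVar_prime htp
    (fun a b => GenSym.scaleVar_dvd_minor τ a b)
    (fun N f => GenSym.mem_weightIdeal_of_dvd (Fintype.equivFin _).symm) (h := h) (r := r) hm
  refine hval ?_
  rw [hh, show p - τ = p - (τ + 1) + 1 by omega, Nat.le_div_iff_mul_le two_pos]
  exact Nat.mul_le_mul_left _ (by omega)
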